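/- arXiv:2602.17878 — 3 statements merged into one kernel-verified Lean document; each statement's English description precedes it below -/
import Mathlib

section
/- Let ψ = g + h where g is μ-strongly convex (μ ≥ 0) and (L+μ)-smooth (L > 0) on ℝⁿ and h is proper closed convex with dom h ⊆ dom g, and suppose the set X_* of minimizers of ψ is nonempty. Let R_0 = min{‖x − x_0‖ : x ∈ X_*}. Then the iterates of the ACG method satisfy, for all j ≥ 1: ψ(y_j) − ψ(x_*) ≤ R_0²/(2A_j), and the gradient mapping with stepsize (2L+μ)⁻¹ satisfies ‖G^{(2L+μ)⁻¹}_ψ(x̃_{j−1})‖ ≤ (2L+μ)R_0/√(L·A_j). -/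
noncomputable section

open Set
open scoped RealInnerProductSpace BigOperators

/-- `n`-dimensional Euclidean space. -/
abbrev Euc (k : ℕ) : Type := EuclideanSpace ℝ (Fin k)

variable {n m : ℕ}

/-- `f` is `μ`-strongly convex on the set `s` (with `μ = 0` this is convexity on `s`). -/
def SCOn (s : Set (Euc n)) (mu : ℝ) (f : Euc n → ℝ) : Prop :=
  ∀ ⦃x⦄, x ∈ s → ∀ ⦃y⦄, y ∈ s → ∀ ⦃a c : ℝ⦄, 0 ≤ a → 0 ≤ c → a + c = 1 →
    f (a • x + c • y) ≤ a * f x + c * f y - mu / 2 * (a * c) * ‖x - y‖ ^ 2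

/-- The convex subdifferential of `f` at `x` relative to the domain `s`
(`f` is interpreted as `+∞` outside of `s`). -/
def subdiffOn (s : Set (Euc n)) (f : Euc n → ℝ) (x : Euc n) : Set (Euc n) :=
  {v | ∀ y ∈ s, f x + ⟪v, y - x⟫ ≤ f y}

/-- `p = prox_{η h}(x)`, where `h` is interpreted as `+∞` outside of `s`. -/
def IsProxPt (s : Set (Euc n)) (h : Euc n → ℝ) (eta : ℝ) (x p : Euc n) : Prop :=
  p ∈ s ∧ ∀ ⦃y⦄, y ∈ s → eta * h p + ‖p - x‖ ^ 2 / 2 ≤ eta * h y + ‖y - x‖ ^ 2 / 2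

/-- `f` is differentiable with gradient `f'`, and `f'` is `L`-Lipschitz (i.e. `f` is `L`-smooth). -/
def HasLipGrad (f : Euc n → ℝ) (f' : Euc n → Euc n) (L : ℝ) : Prop :=
  (∀ x, HasGradientAt f (f' x) x) ∧ ∀ x y, ‖f' x - f' y‖ ≤ L * ‖x - y‖
/-- One full run of the ACG method (Algorithm 1) on `ψ = g + h` with parameters `L`, `μ`,
started at `x0 ∈ dom h`.  The minimizations defining `ỹ_{j+1}` are taken over `dom h`
(`h` is interpreted as `+∞` outside of `dom h`). -/
def ACGSpec (domh : Set (Euc n)) (g h : Euc n → ℝ) (g' : Euc n → Euc n) (L mu : ℝ)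
    (x0 : Euc n) (x y xt yt : ℕ → Euc n) (a A tau : ℕ → ℝ) : Prop :=
  A 0 = 0 ∧ tau 0 = 1 ∧ x 0 = x0 ∧ y 0 = x0 ∧ x0 ∈ domh ∧
  (∀ j, a j = (tau j + Real.sqrt (tau j ^ 2 + 8 * tau j * A j * L)) / (4 * L)) ∧
  (∀ j, A (j + 1) = A j + a j) ∧
  (∀ j, tau (j + 1) = tau j + mu * a j) ∧
  (∀ j, xt j = (A j / A (j + 1)) • y j + (a j / A (j + 1)) • x j) ∧
  (∀ j, yt (j + 1) ∈ domh) ∧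
  (∀ j, ∀ u ∈ domh,
      g (xt j) + ⟪g' (xt j), yt (j + 1) - xt j⟫ + h (yt (j + 1)) +
          (2 * L + mu) / 2 * ‖yt (j + 1) - xt j‖ ^ 2 ≤
        g (xt j) + ⟪g' (xt j), u - xt j⟫ + h u +
          (2 * L + mu) / 2 * ‖u - xt j‖ ^ 2) ∧
  (∀ j, (y (j + 1) = y j ∨ y (j + 1) = yt (j + 1)) ∧
      g (y (j + 1)) + h (y (j + 1)) ≤ g (y j) + h (y j) ∧
      g (y (j + 1)) + h (y (j + 1)) ≤ g (yt (j + 1)) + h (yt (j + 1))) ∧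
  (∀ j, x (j + 1) = (A (j + 1) * mu + 1)⁻¹ •
      (((2 * L + mu) * a j) • yt (j + 1) -
        (2 * A j * a j * L / A (j + 1)) • y j))

/-- The aggregate lower model `Θ_j` of the ACG run: `Θ_0 ≡ 0` and
`Θ_{j+1} = (A_j Θ_j + a_j θ_{j+1})/A_{j+1}`, where
`θ_{j+1}(w) = Γ_j(ỹ_{j+1}) - L‖ỹ_{j+1} - x̃_j‖² + ⟪2L(x̃_j - ỹ_{j+1}), w - ỹ_{j+1}⟫ + (μ/2)‖w - ỹ_{j+1}‖²`
and `Γ_j(u) = g(x̃_j) + ⟪∇g(x̃_j), u - x̃_j⟫ + h(u) + ((2L+μ)/2)‖u - x̃_j‖²`. -/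
def ThetaSpec (g h : Euc n → ℝ) (g' : Euc n → Euc n) (L mu : ℝ)
    (xt yt : ℕ → Euc n) (a A : ℕ → ℝ) (Th : ℕ → Euc n → ℝ) : Prop :=
  (∀ w, Th 0 w = 0) ∧
  ∀ j w, Th (j + 1) w =
    (A j * Th j w + a j *
      (g (xt j) + ⟪g' (xt j), yt (j + 1) - xt j⟫ + h (yt (j + 1)) +
          (2 * L + mu) / 2 * ‖yt (j + 1) - xt j‖ ^ 2 -
        L * ‖yt (j + 1) - xt j‖ ^ 2 +
        ⟪(2 * L) • (xt j - yt (j + 1)), w - yt (j + 1)⟫ +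
        mu / 2 * ‖w - yt (j + 1)‖ ^ 2)) / A (j + 1)
/-!
STATEMENT 0 (Lemma: convergence rates of the ACG method).
-/

theorem aux_lim {c d : ℝ} (H : ∀ t : ℝ, 0 < t → t < 1 → c * (1 - t) ≤ d) : c ≤ d := by
  by_contra hc
  push Not at hc
  have h1 := H (1/2) (by norm_num) (by norm_num)
  by_cases hc0 : c ≤ 0
  · nlinarith
  push Not at hc0
  have hd : 0 < d := by nlinarith
  have h2 := H ((c - d) / (2 * c)) (by apply div_pos <;> linarith)
    (by rw [div_lt_one (by linarith)]; linarith)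
  have : c * (1 - (c - d) / (2 * c)) = (c + d) / 2 := by field_simp; ring
  linarith

theorem aux_line {g : Euc n → ℝ} {g' : Euc n → Euc n} (hg : ∀ x, HasGradientAt g (g' x) x)
    (x d : Euc n) (t : ℝ) :
    HasDerivAt (fun s : ℝ => g (x + s • d)) ⟪g' (x + t • d), d⟫ t := by
  have h1 := (hg (x + t • d)).hasFDerivAt
  have h2 : HasDerivAt (fun s : ℝ => x + s • d) d t := by
    simpa using ((hasDerivAt_id t).smul_const d).const_add x
  have := h1.comp_hasDerivAt t h2
  exact this.congr_deriv (by simp)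

theorem aux_descent {g : Euc n → ℝ} {g' : Euc n → Euc n} {M : ℝ} (hg : HasLipGrad g g' M)
    (x w : Euc n) : g w ≤ g x + ⟪g' x, w - x⟫ + M / 2 * ‖w - x‖ ^ 2 := by
  set d := w - x with hd
  have hder : ∀ t : ℝ, HasDerivAt
      (fun s : ℝ => g (x + s • d) - s * ⟪g' x, d⟫ - M / 2 * ‖d‖ ^ 2 * s ^ 2)
      (⟪g' (x + t • d), d⟫ - ⟪g' x, d⟫ - M * ‖d‖ ^ 2 * t) t := by
    intro t
    have := ((aux_line hg.1 x d t).sub ((hasDerivAt_id t).mul_const ⟪g' x, d⟫)).sub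
      (((hasDerivAt_id t).pow 2).const_mul (M / 2 * ‖d‖ ^ 2))
    refine this.congr_deriv ?_
    simp
    ring
  have hanti : AntitoneOn
      (fun s : ℝ => g (x + s • d) - s * ⟪g' x, d⟫ - M / 2 * ‖d‖ ^ 2 * s ^ 2) (Set.Ici 0) := by
    apply antitoneOn_of_deriv_nonpos (convex_Ici 0)
    · exact fun t _ => (hder t).continuousAt.continuousWithinAt
    · exact fun t _ => (hder t).differentiableAt.differentiableWithinAt
    · intro t ht
      rw [(hder t).deriv]
      have ht0 : 0 < t := by simpa using ht
      have h1 : ⟪g' (x + t • d) - g' x, d⟫ ≤ ‖g' (x + t • d) - g' x‖ * ‖d‖ :=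
        real_inner_le_norm _ _
      have h2 := hg.2 (x + t • d) x
      have h3 : ‖x + t • d - x‖ = t * ‖d‖ := by
        rw [add_sub_cancel_left, norm_smul, Real.norm_of_nonneg ht0.le]
      rw [h3] at h2
      rw [inner_sub_left] at h1
      nlinarith [mul_le_mul_of_nonneg_right h2 (norm_nonneg d)]
  have := hanti (show (0:ℝ) ∈ Set.Ici 0 by simp) (show (1:ℝ) ∈ Set.Ici 0 by simp) zero_le_one
  simp [hd] at this
  rw [← hd] at this
  linarith

theorem aux_sc {g : Euc n → ℝ} {g' : Euc n → Euc n} {mu : ℝ} (hg : ∀ x, HasGradientAt g (g' x) x)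
    (hsc : SCOn Set.univ mu g) (x w : Euc n) :
    g x + ⟪g' x, w - x⟫ + mu / 2 * ‖w - x‖ ^ 2 ≤ g w := by
  set d := w - x with hd
  have hder := aux_line hg x d 0
  simp only [zero_smul, add_zero] at hder
  have hF : HasDerivAt (fun s : ℝ => g (x + s • d) - ((1 - s) * g x + s * g w - 
      mu / 2 * ((1 - s) * s) * ‖d‖ ^ 2)) (⟪g' x, d⟫ - (g w - g x - mu / 2 * ‖d‖ ^ 2)) 0 := by
    have h1 := (hasDerivAt_id (0:ℝ)).const_sub 1
    have h2 := ((h1.mul_const (g x)).add ((hasDerivAt_id (0:ℝ)).mul_const (g w))).sub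
      (((h1.mul (hasDerivAt_id (0:ℝ))).const_mul (mu / 2)).mul_const (‖d‖ ^ 2))
    refine (hder.sub h2).congr_deriv ?_
    simp
    ring
  have hle : ∀ s : ℝ, 0 ≤ s → s ≤ 1 → g (x + s • d) - ((1 - s) * g x + s * g w - 
      mu / 2 * ((1 - s) * s) * ‖d‖ ^ 2) ≤ 0 := by
    intro s h0 h1
    have := hsc (Set.mem_univ x) (Set.mem_univ w) (sub_nonneg.2 h1) h0 (by ring)
    have e : (1 - s) • x + s • w = x + s • d := by rw [hd]; module
    rw [e, norm_sub_rev x w] at this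
    linarith
  have hneg : ⟪g' x, d⟫ - (g w - g x - mu / 2 * ‖d‖ ^ 2) ≤ 0 := by
    have ht := hF.tendsto_slope_zero_right
    refine le_of_tendsto ht ?_
    filter_upwards [Ioo_mem_nhdsGT (zero_lt_one (α := ℝ))] with t ht
    have := hle t ht.1.le ht.2.le
    simp only [smul_eq_mul, zero_add, zero_smul, add_zero] 
    apply mul_nonpos_of_nonneg_of_nonpos (inv_nonneg.2 ht.1.le)
    linarith
  linarith

theorem aux_min {domh : Set (Euc n)} {h : Euc n → ℝ} (hh : ConvexOn ℝ domh h) {K c : ℝ}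
    {v z p : Euc n} (hp : p ∈ domh)
    (hmin : ∀ u ∈ domh, c + ⟪v, p - z⟫ + h p + K / 2 * ‖p - z‖ ^ 2 ≤
      c + ⟪v, u - z⟫ + h u + K / 2 * ‖u - z‖ ^ 2) (u : Euc n) (hu : u ∈ domh) :
    c + ⟪v, p - z⟫ + h p + K / 2 * ‖p - z‖ ^ 2 + K / 2 * ‖u - p‖ ^ 2 ≤
      c + ⟪v, u - z⟫ + h u + K / 2 * ‖u - z‖ ^ 2 := by
  suffices K / 2 * ‖u - p‖ ^ 2 ≤ (c + ⟪v, u - z⟫ + h u + K / 2 * ‖u - z‖ ^ 2) -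
      (c + ⟪v, p - z⟫ + h p + K / 2 * ‖p - z‖ ^ 2) by linarith
  apply aux_lim
  intro t h0 h1
  have hmem := hh.1 hp hu (sub_nonneg.2 h1.le) h0.le (by ring)
  have hc := hh.2 hp hu (sub_nonneg.2 h1.le) h0.le (by ring)
  have hm := hmin _ hmem
  simp only [smul_eq_mul] at hc
  have e : (1 - t) • p + t • u - z = (p - z) + t • (u - p) := by module
  have e2 : u - z = (p - z) + (u - p) := by module
  rw [e, norm_add_sq_real, inner_add_right, norm_smul, inner_smul_right, inner_smul_right,
    Real.norm_of_nonneg h0.le] at hm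
  rw [e2, norm_add_sq_real, inner_add_right]
  refine le_of_mul_le_mul_left ?_ h0
  nlinarith

theorem aux_step {L mu a A Ap tau taup c : ℝ} {x y xt yt xp w : Euc n}
    (hL : 0 < L) (hmu : 0 ≤ mu) (ha : 0 < a) (hA : 0 ≤ A) (hAp : Ap = A + a)
    (htau : 0 < tau) (htp : taup = tau + mu * a) (hq : 2 * L * a ^ 2 = tau * Ap)
    (hxt : Ap • xt = A • y + a • x)
    (hxp : taup • xp = ((2 * L + mu) * a) • yt - (2 * A * a * L / Ap) • y)
    {psiy psiyp psiw : ℝ}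
    (h1 : psiyp ≤ c - L / 2 * ‖yt - xt‖ ^ 2)
    (h2 : c - L * ‖yt - xt‖ ^ 2 + ⟪(2 * L) • (xt - yt), y - yt⟫ + mu / 2 * ‖y - yt‖ ^ 2 ≤ psiy)
    (h3 : c - L * ‖yt - xt‖ ^ 2 + ⟪(2 * L) • (xt - yt), w - yt⟫ + mu / 2 * ‖w - yt‖ ^ 2 ≤ psiw) :
    Ap * (psiyp - psiw) + taup / 2 * ‖w - xp‖ ^ 2 + L * Ap / 2 * ‖yt - xt‖ ^ 2 ≤
      A * (psiy - psiw) + tau / 2 * ‖w - x‖ ^ 2 := by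
  have hApp : 0 < Ap := by linarith
  have htpp : 0 < taup := by rw [htp]; positivity
  set v := xt - yt with hv
  set r := w - x with hr
  set s := w - yt with hs
  have hd : ‖yt - xt‖ = ‖v‖ := norm_sub_rev _ _
  rw [hd] at h1 h2 h3 ⊢
  -- optimality
  have ho : taup • (w - xp) = tau • r + (a * mu) • s + (2 * L * a) • v := by
    have hay : (2 * A * a * L / Ap) • y = (2 * L * a) • xt - tau • x := by
      have : (2 * A * a * L / Ap) • y = (2 * L * a / Ap) • (A • y) := by
        rw [smul_smul]; congr 1; ring
      rw [this, show A • y = Ap • xt - a • x by rw [hxt]; abel, smul_sub, smul_smul, smul_smul]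
      congr 2
      · field_simp
      · field_simp; linarith
    rw [smul_sub, hxp, hay, hr, hs, hv, htp]
    module
  have hAy : A * ⟪(2 * L) • v, y - yt⟫ + a * ⟪(2 * L) • v, s⟫ =
      2 * L * Ap * ‖v‖ ^ 2 + 2 * L * a * ⟪v, r⟫ := by
    have e : A • (y - yt) + a • s = Ap • v + a • r := by
      rw [hs, hv, hr, smul_sub Ap, hxt, hAp]; module
    rw [← inner_smul_right, ← inner_smul_right, ← inner_add_right, e, inner_smul_left,
      inner_add_right, inner_smul_right, inner_smul_right, real_inner_self_eq_norm_sq]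
    simp; ring
  have hsq : taup ^ 2 * ‖w - xp‖ ^ 2 = ‖tau • r + (a * mu) • s + (2 * L * a) • v‖ ^ 2 := by
    rw [← ho, norm_smul, mul_pow, Real.norm_of_nonneg htpp.le]
  -- key quadratic inequality
  have key : taup / 2 * ‖w - xp‖ ^ 2 ≤ tau / 2 * ‖r‖ ^ 2 + 2 * L * a * ⟪v, r⟫ +
      a * mu / 2 * ‖s‖ ^ 2 + L * Ap * ‖v‖ ^ 2 := by
    -- with q = tau • r + 2La • v : RHS = ‖q‖²/(2 tau) + a mu/2 ‖s‖²
    set q := tau • r + (2 * L * a) • v with hqd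
    have hq2 : ‖q‖ ^ 2 = 2 * tau * (tau / 2 * ‖r‖ ^ 2 + 2 * L * a * ⟪v, r⟫ + L * Ap * ‖v‖ ^ 2) := by
      rw [hqd, norm_add_sq_real, norm_smul, norm_smul, inner_smul_left, inner_smul_right,
        real_inner_comm, Real.norm_of_nonneg htau.le, Real.norm_of_nonneg (by positivity)]
      simp
      linear_combination 2 * L * ‖v‖ ^ 2 * hq
    have hs2 : taup ^ 2 * ‖w - xp‖ ^ 2 = ‖q‖ ^ 2 + 2 * (a * mu) * ⟪q, s⟫ +
        (a * mu) ^ 2 * ‖s‖ ^ 2 := by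
      rw [hsq, show tau • r + (a * mu) • s + (2 * L * a) • v = q + (a * mu) • s by rw [hqd]; abel,
        norm_add_sq_real, norm_smul, inner_smul_right, mul_pow, Real.norm_eq_abs, sq_abs]
      ring
    have hpos : 0 ≤ ‖q - tau • s‖ ^ 2 := by positivity
    rw [norm_sub_sq_real, norm_smul, inner_smul_right, Real.norm_of_nonneg htau.le] at hpos
    have ham : 0 ≤ a * mu := by positivity
    have := mul_nonneg ham hpos
    refine le_of_mul_le_mul_left ?_ (show 0 < 2 * taup * tau by positivity)
    have e1 : 2 * taup * tau * (taup / 2 * ‖w - xp‖ ^ 2) = tau * (taup ^ 2 * ‖w - xp‖ ^ 2) := by ring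
    rw [e1, hs2]
    have e2 : 2 * taup * tau * (tau / 2 * ‖r‖ ^ 2 + 2 * L * a * ⟪v, r⟫ +
      a * mu / 2 * ‖s‖ ^ 2 + L * Ap * ‖v‖ ^ 2) = taup * ‖q‖ ^ 2 + taup * tau * (a * mu) * ‖s‖ ^ 2 := by
      rw [hq2]; ring
    rw [e2, htp]
    linarith
  have g1 := mul_le_mul_of_nonneg_left h1 hApp.le
  have hyy : 0 ≤ mu / 2 * ‖y - yt‖ ^ 2 := by positivity
  have g2 := mul_le_mul_of_nonneg_left h2 hA
  have g3 := mul_le_mul_of_nonneg_left h3 ha.le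
  have g4 := mul_nonneg hA hyy
  subst hAp
  linarith

theorem aux_theta {domh : Set (Euc n)} {g h : Euc n → ℝ} {g' : Euc n → Euc n}
    {L mu : ℝ} (hgsc : SCOn Set.univ mu g) (hg : ∀ x, HasGradientAt g (g' x) x)
    (hh : ConvexOn ℝ domh h) {z p : Euc n} (hp : p ∈ domh)
    (hmin : ∀ u ∈ domh, g z + ⟪g' z, p - z⟫ + h p + (2 * L + mu) / 2 * ‖p - z‖ ^ 2 ≤
      g z + ⟪g' z, u - z⟫ + h u + (2 * L + mu) / 2 * ‖u - z‖ ^ 2) (u : Euc n) (hu : u ∈ domh) :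
    (g z + ⟪g' z, p - z⟫ + h p + (2 * L + mu) / 2 * ‖p - z‖ ^ 2) - L * ‖p - z‖ ^ 2 +
      ⟪(2 * L) • (z - p), u - p⟫ + mu / 2 * ‖u - p‖ ^ 2 ≤ g u + h u := by
  have h1 := aux_min hh hp hmin u hu
  have h2 := aux_sc hg hgsc z u
  have h3 : ‖u - z‖ ^ 2 = ‖u - p‖ ^ 2 - 2 * ⟪z - p, u - p⟫ + ‖p - z‖ ^ 2 := by
    rw [show u - z = (u - p) - (z - p) by abel, norm_sub_sq_real, norm_sub_rev z p,
      real_inner_comm]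
  have h4 : ⟪(2 * L) • (z - p), u - p⟫ = 2 * L * ⟪z - p, u - p⟫ := by
    rw [inner_smul_left]; simp
  rw [h4]
  rw [h3] at h1 h2
  nlinarith

theorem acg_convergence
    (domh : Set (Euc n)) (g h : Euc n → ℝ) (g' : Euc n → Euc n)
    (L mu : ℝ) (hL : 0 < L) (hmu : 0 ≤ mu)
    -- `g` is `μ`-strongly convex and `(L+μ)`-smooth on `ℝⁿ`
    (hgsc : SCOn Set.univ mu g) (hgsmooth : HasLipGrad g g' (L + mu))
    -- `h` is proper closed convex with `dom h ⊆ dom g`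
    (hhconv : ConvexOn ℝ domh h) (hdomclosed : IsClosed domh)
    (hhlsc : LowerSemicontinuousOn h domh) (hdomne : domh.Nonempty)
    -- a run of the ACG method on `ψ = g + h`
    (x y xt yt : ℕ → Euc n) (a A tau : ℕ → ℝ) (x0 : Euc n)
    (hrun : ACGSpec domh g h g' L mu x0 x y xt yt a A tau)
    -- `xstar ∈ X_*` attains the minimum distance `R0` from `x0`
    (xstar : Euc n) (R0 : ℝ)
    (hxstar : xstar ∈ domh)
    (hxstarmin : ∀ u ∈ domh, g xstar + h xstar ≤ g u + h u)
    (hR0 : R0 = ‖xstar - x0‖)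
    (hR0min : ∀ z ∈ domh, (∀ u ∈ domh, g z + h z ≤ g u + h u) → R0 ≤ ‖z - x0‖) :
    ∀ j : ℕ, 1 ≤ j →
      -- objective gap bound
      (g (y j) + h (y j) - (g xstar + h xstar) ≤ R0 ^ 2 / (2 * A j)) ∧
      -- gradient mapping bound: for the prox point `p = prox_{(2L+μ)⁻¹ h}(x̃_{j-1} - (2L+μ)⁻¹∇g(x̃_{j-1}))`,
      -- `‖G^{(2L+μ)⁻¹}_ψ(x̃_{j-1})‖ = (2L+μ)‖x̃_{j-1} - p‖ ≤ (2L+μ)R₀/√(L·A_j)`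
      (∀ p : Euc n,
        IsProxPt domh h (2 * L + mu)⁻¹
          (xt (j - 1) - (2 * L + mu)⁻¹ • g' (xt (j - 1))) p →
        ‖(2 * L + mu) • (xt (j - 1) - p)‖ ≤ (2 * L + mu) * R0 / Real.sqrt (L * A j)) := by
  obtain ⟨hA0, htau0, hx0, hy0, hx0d, ha, hA, htau, hxt, hytd, hmin, hy, hx⟩ := hrun
  have hpos : ∀ j, 0 ≤ A j ∧ tau j = 1 + mu * A j := by
    intro j
    induction j with
    | zero => simp [hA0, htau0]
    | succ j ih =>
      obtain ⟨h1, h2⟩ := ih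
      have h3 : 0 < tau j := by rw [h2]; positivity
      have h4 : 0 ≤ a j := by rw [ha]; positivity
      refine ⟨by rw [hA]; linarith, ?_⟩
      rw [htau, hA, h2]; ring
  have htp : ∀ j, 0 < tau j := fun j => by
    rw [(hpos j).2]; have := (hpos j).1; positivity
  have hap : ∀ j, 0 < a j := fun j => by
    rw [ha]; have := htp j; positivity
  have hAp : ∀ j, 0 < A (j + 1) := fun j => by
    rw [hA]; linarith [hap j, (hpos j).1]
  have hq : ∀ j, 2 * L * a j ^ 2 = tau j * A (j + 1) := by
    intro j
    have h1 := htp j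
    have h2 := (hpos j).1
    have hs := Real.sq_sqrt (show 0 ≤ tau j ^ 2 + 8 * tau j * A j * L by positivity)
    have haj := ha j
    set S := Real.sqrt (tau j ^ 2 + 8 * tau j * A j * L)
    have h3 : S = 4 * L * a j - tau j := by rw [haj]; field_simp; ring
    rw [h3] at hs
    rw [hA]
    refine mul_left_cancel₀ (show 8 * L ≠ 0 by positivity) ?_
    linarith
  have hyd : ∀ j, y j ∈ domh := by
    intro j
    induction j with
    | zero => rw [hy0]; exact hx0d
    | succ j ih =>
      rcases (hy j).1 with h1 | h1 <;> rw [h1]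
      · exact ih
      · exact hytd j
  have hstep : ∀ j, A (j + 1) * ((g (y (j + 1)) + h (y (j + 1))) - (g xstar + h xstar)) +
      tau (j + 1) / 2 * ‖xstar - x (j + 1)‖ ^ 2 + L * A (j + 1) / 2 * ‖yt (j + 1) - xt j‖ ^ 2 ≤
      A j * ((g (y j) + h (y j)) - (g xstar + h xstar)) + tau j / 2 * ‖xstar - x j‖ ^ 2 := by
    intro j
    refine aux_step (y := y j) (yt := yt (j + 1)) (xt := xt j) (c := g (xt j) + ⟪g' (xt j), yt (j + 1) - xt j⟫ + h (yt (j + 1)) +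
          (2 * L + mu) / 2 * ‖yt (j + 1) - xt j‖ ^ 2)
      hL hmu (hap j) (hpos j).1 (hA j) (htp j) (htau j) (hq j) ?_ ?_ ?_
      (aux_theta hgsc hgsmooth.1 hhconv (hytd j) (hmin j) _ (hyd j))
      (aux_theta hgsc hgsmooth.1 hhconv (hytd j) (hmin j) _ hxstar)
    · have := (hAp j).ne'
      rw [hxt, smul_add, smul_smul, smul_smul, mul_div_cancel₀ _ this, mul_div_cancel₀ _ this]
    · have e : A (j + 1) * mu + 1 = tau (j + 1) := by rw [(hpos (j + 1)).2]; ring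
      rw [hx, e, smul_smul, mul_inv_cancel₀ (htp _).ne', one_smul]
    · have h1 := (hy j).2.2
      have h2 := aux_descent hgsmooth (xt j) (yt (j + 1))
      linarith
  have hE : ∀ j, A j * ((g (y j) + h (y j)) - (g xstar + h xstar)) +
      tau j / 2 * ‖xstar - x j‖ ^ 2 ≤ R0 ^ 2 / 2 := by
    intro j
    induction j with
    | zero => rw [hA0, htau0, hx0, hR0]; linarith
    | succ j ih =>
      have h1 := hstep j
      have h2 : 0 ≤ L * A (j + 1) / 2 * ‖yt (j + 1) - xt j‖ ^ 2 := by
        have := hAp j; positivity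
      linarith
  intro j hj
  obtain ⟨j, rfl⟩ : ∃ k, j = k + 1 := ⟨j - 1, by omega⟩
  have hAj := hAp j
  have ht2 : 0 ≤ tau (j + 1) / 2 * ‖xstar - x (j + 1)‖ ^ 2 := by
    have := htp (j + 1); positivity
  refine ⟨?_, ?_⟩
  · rw [le_div_iff₀ (by positivity)]
    have := hE (j + 1)
    linarith
  · intro p hp
    rw [Nat.add_sub_cancel] at hp ⊢
    have hK : 0 < 2 * L + mu := by positivity
    have hR : 0 ≤ R0 := by rw [hR0]; positivity
    have hpy : p = yt (j + 1) := by
      have h1 := aux_min hhconv (hytd j) (hmin j) p hp.1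
      have h2 := hp.2 (hytd j)
      have ex : ∀ u : Euc n, (2 * L + mu) * ((2 * L + mu)⁻¹ * h u +
          ‖u - (xt j - (2 * L + mu)⁻¹ • g' (xt j))‖ ^ 2 / 2) = h u + ⟪g' (xt j), u - xt j⟫ +
          (2 * L + mu) / 2 * ‖u - xt j‖ ^ 2 + (2 * L + mu)⁻¹ / 2 * ‖g' (xt j)‖ ^ 2 := by
        intro u
        rw [show u - (xt j - (2 * L + mu)⁻¹ • g' (xt j)) =
          (u - xt j) + (2 * L + mu)⁻¹ • g' (xt j) by abel, norm_add_sq_real, norm_smul,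
          inner_smul_right, real_inner_comm, Real.norm_of_nonneg (by positivity)]
        field_simp
        ring
      have h3 := mul_le_mul_of_nonneg_left h2 hK.le
      rw [ex, ex] at h3
      have h4 : (2 * L + mu) / 2 * ‖p - yt (j + 1)‖ ^ 2 ≤ 0 := by linarith
      have h5 : ‖p - yt (j + 1)‖ ^ 2 ≤ 0 := by
        by_contra hc
        push Not at hc
        have : 0 < (2 * L + mu) / 2 * ‖p - yt (j + 1)‖ ^ 2 := by positivity
        linarith
      have h6 : ‖p - yt (j + 1)‖ = 0 := by
        have := sq_nonneg ‖p - yt (j + 1)‖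
        exact pow_eq_zero_iff (two_ne_zero) |>.1 (le_antisymm h5 this)
      exact sub_eq_zero.1 (norm_eq_zero.1 h6)
    rw [hpy, norm_smul, Real.norm_of_nonneg hK.le, mul_div_assoc]
    refine mul_le_mul_of_nonneg_left ?_ hK.le
    have hLA : 0 < L * A (j + 1) := by positivity
    rw [le_div_iff₀ (Real.sqrt_pos.2 hLA)]
    refine abs_le_of_sq_le_sq' ?_ hR |>.2
    rw [mul_pow, Real.sq_sqrt hLA.le, norm_sub_rev]
    have h1 := hstep j
    have h2 := hE j
    have h3 : 0 ≤ A (j + 1) * ((g (y (j + 1)) + h (y (j + 1))) - (g xstar + h xstar)) :=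
      mul_nonneg hAj.le (sub_nonneg.2 (hxstarmin _ (hyd _)))
    linarith
end
end

section
/- Let φ = f + h on ℝⁿ with f proper closed, μ_f-strongly convex and L_f-smooth, L_f ≥ 2μ_f ≥ 0, h proper closed convex with simple proximal mapping, dom h ⊆ dom f, minimizer set X_* nonempty, and R_0 = min{‖w_0 − x‖ : x ∈ X_*}. For given ε > 0: (a) if μ_f = 0 and 1/L_f ≤ λ ≤ R_0²/ε, the total number of ACG iterations that Restarted ACG performs before producing a point w_k with φ(w_k) − φ_* ≤ ε is at most R_0√(L_f/ε) up to a universal constant factor and factors polylogarithmic in σ⁻¹λL_f; (b) if μ_f > 0 and 1/(L_f − μ_f) ≤ λ ≤ min{1/μ_f, R_0²/ε}, the total number of ACG iterations is at most min{√(L_f/μ_f), R_0√(L_f/ε)} up to a universal constant factor and factors polylogarithmic in σ⁻¹λ(L_f − μ_f), R_0²/(λε) and 1/(λμ_f). -/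
noncomputable section

open Set
open scoped RealInnerProductSpace BigOperators

variable {n m : ℕ}

/-- A full run of the Restarted ACG method (Algorithm 2) on `φ = f + h`, with inner ACG
runs `(xin k, yin k, xtin k, ytin k, ain k, Ain k, tauin k)` on the proximal subproblem
`ψ_k(·) = f(·) + h(·) + ‖· - ṽ_k‖²/(2λ)`, aggregate lower models `Thin k`, and inner
termination indices `J k` at which the restart condition is satisfied. -/
def RestartSpec (domh : Set (Euc n)) (f h : Euc n → ℝ) (f' : Euc n → Euc n)
    (muf Lf lam sigma : ℝ)
    (w v vt : ℕ → Euc n) (bo Bo tauo : ℕ → ℝ)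
    (xin yin xtin ytin : ℕ → ℕ → Euc n) (ain Ain tauin : ℕ → ℕ → ℝ)
    (Thin : ℕ → ℕ → Euc n → ℝ) (J : ℕ → ℕ) : Prop :=
  Bo 0 = 0 ∧ tauo 0 = 1 ∧ v 0 = w 0 ∧ w 0 ∈ domh ∧
  (∀ k, bo k = (tauo k * lam +
      Real.sqrt (tauo k ^ 2 * lam ^ 2 + 4 * tauo k * lam * Bo k)) / 2) ∧
  (∀ k, Bo (k + 1) = Bo k + bo k) ∧
  (∀ k, tauo (k + 1) = tauo k + bo k * muf) ∧
  (∀ k, vt k = (Bo k / Bo (k + 1)) • w k + (bo k / Bo (k + 1)) • v k) ∧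
  -- inner ACG runs on `ψ_k` from `x_0 = ṽ_k` with `L = L_f - μ_f`, `μ = μ_f + 1/λ`
  (∀ k, ACGSpec domh (fun u => f u + ‖u - vt k‖ ^ 2 / (2 * lam)) h
      (fun u => f' u + lam⁻¹ • (u - vt k)) (Lf - muf) (muf + 1 / lam)
      (vt k) (xin k) (yin k) (xtin k) (ytin k) (ain k) (Ain k) (tauin k)) ∧
  (∀ k, ThetaSpec (fun u => f u + ‖u - vt k‖ ^ 2 / (2 * lam)) h
      (fun u => f' u + lam⁻¹ • (u - vt k)) (Lf - muf) (muf + 1 / lam)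
      (xtin k) (ytin k) (ain k) (Ain k) (Thin k)) ∧
  (∀ k, 1 ≤ J k) ∧
  -- the restart condition holds at inner iteration `J k`
  (∀ k,
      ‖lam • ((Ain k (J k))⁻¹ • (vt k - xin k (J k)))‖ ^ 2 +
        2 * lam * ((f (yin k (J k)) + ‖yin k (J k) - vt k‖ ^ 2 / (2 * lam) +
            h (yin k (J k))) - Thin k (J k) (xin k (J k))) ≤
      sigma * ‖yin k (J k) - vt k‖ ^ 2) ∧
  -- `w_{k+1}` is the better of `w_k` and the output `y_{J k}` of the inner call
  (∀ k, (w (k + 1) = w k ∨ w (k + 1) = yin k (J k)) ∧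
      f (w (k + 1)) + h (w (k + 1)) ≤ f (w k) + h (w k) ∧
      f (w (k + 1)) + h (w (k + 1)) ≤ f (yin k (J k)) + h (yin k (J k))) ∧
  -- the `v`-update
  (∀ k, v (k + 1) = (tauo (k + 1))⁻¹ •
      (tauo k • v k + (bo k * muf) • xin k (J k) -
        (bo k * (Ain k (J k) + lam) / lam) •
          ((Ain k (J k))⁻¹ • (vt k - xin k (J k)))))
/-!
STATEMENT 2 (Theorem: total iteration-complexity of Restarted ACG).
There are universal constants `c` (constant factor and polylog exponent) such that for every
problem instance and every run of Restarted ACG (with each inner ACG call stopped at the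
first iteration satisfying the restart condition), the total number of ACG iterations
performed before producing an `ε`-solution `w_K` is bounded as stated.
-/


lemma aux_lim_s2 {P Q : ℝ} (H : ∀ t : ℝ, 0 < t → t ≤ 1 → 0 ≤ P + t * Q) : 0 ≤ P := by
  by_contra hP
  push Not at hP
  have hd : 0 < |Q| - P := by have := abs_nonneg Q; linarith
  have ht : 0 < -P / (2 * (|Q| - P)) := by apply div_pos <;> linarith
  have ht1 : -P / (2 * (|Q| - P)) ≤ 1 := by
    rw [div_le_one (by linarith)]
    have := abs_nonneg Q; linarith
  have h1 := H _ ht ht1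
  have h2 : -P / (2 * (|Q| - P)) * Q ≤ -P / (2 * (|Q| - P)) * (|Q| - P) := by
    apply mul_le_mul_of_nonneg_left _ ht.le
    have := le_abs_self Q; linarith
  have h3 : -P / (2 * (|Q| - P)) * (|Q| - P) = -P / 2 := by
    field_simp
  linarith

lemma line_deriv {f : Euc n → ℝ} {f' : Euc n → Euc n} (hf : ∀ x, HasGradientAt f (f' x) x)
    (x d : Euc n) (t : ℝ) :
    HasDerivAt (fun t : ℝ => f (x + t • d)) ⟪f' (x + t • d), d⟫ t := by
  have h1 := (hf (x + t • d)).hasFDerivAt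
  have h2 : HasDerivAt (fun t : ℝ => x + t • d) d t := by
    simpa using ((hasDerivAt_id t).smul_const d).const_add x
  have h3 := h1.comp_hasDerivAt t h2
  exact h3.congr_deriv (by simp)

lemma grad_lower {f : Euc n → ℝ} {f' : Euc n → Euc n} {mu : ℝ} (hsc : SCOn Set.univ mu f)
    (hf : ∀ x, HasGradientAt f (f' x) x) (x y : Euc n) :
    f x + ⟪f' x, y - x⟫ + mu / 2 * ‖y - x‖ ^ 2 ≤ f y := by
  have h1 := line_deriv hf x (y - x) 0
  have h2 := h1.tendsto_slope_zero_right
  have h3 : Filter.Tendsto (fun t : ℝ => f y - f x - mu / 2 * (1 - t) * ‖y - x‖ ^ 2)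
      (nhdsWithin 0 (Set.Ioi 0)) (nhds (f y - f x - mu / 2 * (1 - 0) * ‖y - x‖ ^ 2)) := by
    apply Filter.Tendsto.mono_left _ nhdsWithin_le_nhds
    apply Continuous.tendsto
    fun_prop
  have h4 := le_of_tendsto_of_tendsto h2 h3 (by
    have : Set.Ioo (0:ℝ) 1 ∈ nhdsWithin (0:ℝ) (Set.Ioi 0) := Ioo_mem_nhdsGT one_pos
    filter_upwards [this] with t ht
    have h5 := hsc (Set.mem_univ x) (Set.mem_univ y) (a := 1 - t) (c := t)
      (by linarith [ht.2]) ht.1.le (by ring)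
    have e : x + (0 + t) • (y - x) = (1 - t) • x + t • y := by module
    simp only [smul_eq_mul, e, zero_smul, add_zero]
    rw [inv_mul_le_iff₀ ht.1, ← norm_sub_rev x y]
    nlinarith [h5])
  simp only [zero_smul, add_zero] at h4
  linarith

lemma grad_upper {f : Euc n → ℝ} {f' : Euc n → Euc n} {L : ℝ} (hf : HasLipGrad f f' L)
    (x y : Euc n) :
    f y ≤ f x + ⟪f' x, y - x⟫ + L / 2 * ‖y - x‖ ^ 2 := by
  set d := y - x with hd
  have hD : ∀ t : ℝ, HasDerivAt (fun t : ℝ => f (x + t • d) - t * ⟪f' x, d⟫ - L / 2 * ‖d‖ ^ 2 * t ^ 2)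
      (⟪f' (x + t • d), d⟫ - ⟪f' x, d⟫ - L / 2 * ‖d‖ ^ 2 * (2 * t)) t := by
    intro t
    have a1 := line_deriv hf.1 x d t
    have a2 := (hasDerivAt_id t).mul_const ⟪f' x, d⟫
    have a3 := (hasDerivAt_pow 2 t).const_mul (L / 2 * ‖d‖ ^ 2)
    exact ((a1.sub a2).sub a3).congr_deriv (by simp)
  have hanti : AntitoneOn (fun t : ℝ => f (x + t • d) - t * ⟪f' x, d⟫ - L / 2 * ‖d‖ ^ 2 * t ^ 2)
      (Set.Icc 0 1) := by
    apply antitoneOn_of_deriv_nonpos (convex_Icc 0 1)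
    · exact fun t _ => (hD t).continuousAt.continuousWithinAt
    · exact fun t _ => (hD t).differentiableAt.differentiableWithinAt
    · intro t ht
      rw [interior_Icc] at ht
      rw [(hD t).deriv, ← inner_sub_left]
      have h1 := real_inner_le_norm (f' (x + t • d) - f' x) d
      have h2 := hf.2 (x + t • d) x
      have h3 : ‖x + t • d - x‖ = t * ‖d‖ := by
        rw [add_sub_cancel_left, norm_smul, Real.norm_of_nonneg ht.1.le]
      rw [h3] at h2
      have h4 := mul_le_mul_of_nonneg_right h2 (norm_nonneg d)
      nlinarith
  have := hanti (Set.left_mem_Icc.2 zero_le_one) (Set.right_mem_Icc.2 zero_le_one) zero_le_one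
  simp only [one_smul, zero_smul, add_zero] at this
  rw [show x + d = y by rw [hd]; abel] at this
  linarith

lemma quad_min {t t' a mu : ℝ} {x x' y p : Euc n} (ht : t' = t + a * mu)
    (hx : t' • x' = t • x + (a * mu) • y - a • p) (u : Euc n) :
    t / 2 * ‖u - x‖ ^ 2 + a * (⟪p, u - y⟫ + mu / 2 * ‖u - y‖ ^ 2) =
      t / 2 * ‖x' - x‖ ^ 2 + a * (⟪p, x' - y⟫ + mu / 2 * ‖x' - y‖ ^ 2) +
        t' / 2 * ‖u - x'‖ ^ 2 := by
  have e1 : u - x = (x' - x) + (u - x') := by abel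
  have e2 : u - y = (x' - y) + (u - x') := by abel
  have h0 : t * ⟪x' - x, u - x'⟫ + a * mu * ⟪x' - y, u - x'⟫ + a * ⟪p, u - x'⟫ = 0 := by
    have : ⟪t' • x' - (t • x + (a * mu) • y - a • p), u - x'⟫ = 0 := by rw [hx]; simp
    rw [ht] at this
    simp only [inner_sub_left, inner_add_left, real_inner_smul_left] at this ⊢
    linarith
  rw [e1, e2, norm_add_sq_real, norm_add_sq_real, inner_add_right, ht]
  linear_combination h0

/-- Consequence of optimality of the prox step. -/
lemma prox_opt {domh : Set (Euc n)} {h : Euc n → ℝ} (hc : ConvexOn ℝ domh h) {q xt yt u : Euc n}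
    {M : ℝ} (hy : yt ∈ domh) (hu : u ∈ domh)
    (H : ∀ u ∈ domh, ⟪q, yt - xt⟫ + h yt + M / 2 * ‖yt - xt‖ ^ 2 ≤
      ⟪q, u - xt⟫ + h u + M / 2 * ‖u - xt‖ ^ 2) :
    0 ≤ ⟪q, u - yt⟫ + h u - h yt + M * ⟪yt - xt, u - yt⟫ := by
  apply aux_lim_s2 (Q := M / 2 * ‖u - yt‖ ^ 2)
  intro t ht ht1
  have h1 := hc.2 hy hu (show (0:ℝ) ≤ 1 - t by linarith) ht.le (by ring)
  have h2 := H _ (hc.1 hy hu (show (0:ℝ) ≤ 1 - t by linarith) ht.le (by ring))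
  have e : (1 - t) • yt + t • u - xt = (yt - xt) + t • (u - yt) := by module
  rw [e, norm_add_sq_real, inner_add_right, real_inner_smul_right, real_inner_smul_right,
    norm_smul, Real.norm_of_nonneg ht.le] at h2
  simp only [smul_eq_mul] at h1
  have : 0 ≤ t * (⟪q, u - yt⟫ + h u - h yt + M * ⟪yt - xt, u - yt⟫ + t * (M / 2 * ‖u - yt‖ ^ 2)) := by
    nlinarith
  exact nonneg_of_mul_nonneg_right this ht

/-- key scalar-quadratic estimate -/
lemma step_est {A a A1 t K c : ℝ} {y x xt p z u : Euc n} (hA1 : A1 = A + a) (hpos : 0 < A1)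
    (ha : t * A1 = K * a ^ 2) (hxt : A1 • xt = A • y + a • x)
    (hm : ∀ d : Euc n, c ≤ ⟪p, xt + d - z⟫ + K / 2 * ‖d‖ ^ 2) :
    A1 * c ≤ A * ⟪p, y - z⟫ + a * ⟪p, u - z⟫ + t / 2 * ‖u - x‖ ^ 2 := by
  have h := hm ((a / A1) • (u - x))
  have e1 : A1 * ⟪p, xt + (a / A1) • (u - x) - z⟫ = A * ⟪p, y - z⟫ + a * ⟪p, u - z⟫ := by
    rw [← real_inner_smul_right, ← real_inner_smul_right, ← real_inner_smul_right,
      ← inner_add_right]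
    congr 1
    have : A1 • (xt + (a / A1) • (u - x) - z) = A1 • xt + (A1 * (a / A1)) • (u - x) - A1 • z := by
      module
    rw [this, hxt, mul_div_cancel₀ _ hpos.ne', hA1]
    module
  have e2 : A1 * (K / 2 * ‖(a / A1) • (u - x)‖ ^ 2) = t / 2 * ‖u - x‖ ^ 2 := by
    rw [norm_smul, mul_pow, Real.norm_eq_abs, sq_abs]
    have : t = K * a ^ 2 / A1 := by field_simp; linarith
    rw [this]; field_simp
  have := mul_le_mul_of_nonneg_left h hpos.le
  rw [mul_add, e1, e2] at this
  exact this

/-- growth step for the accelerated scalar sequences -/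
lemma root_eq {t A K : ℝ} (hK : 0 < K) (ht : 0 ≤ t) (hA : 0 ≤ A) :
    K * ((t + Real.sqrt (t ^ 2 + 4 * t * A * K)) / (2 * K)) ^ 2 =
      t * (A + (t + Real.sqrt (t ^ 2 + 4 * t * A * K)) / (2 * K)) := by
  have h := Real.sq_sqrt (show 0 ≤ t ^ 2 + 4 * t * A * K by positivity)
  set s := Real.sqrt (t ^ 2 + 4 * t * A * K)
  field_simp
  nlinarith

lemma acg_scal {domh : Set (Euc n)} {g h : Euc n → ℝ} {g' : Euc n → Euc n} {L mu : ℝ}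
    {x0 : Euc n} {x y xt yt : ℕ → Euc n} {a A tau : ℕ → ℝ}
    (H : ACGSpec domh g h g' L mu x0 x y xt yt a A tau) (hL : 0 < L) (hmu : 0 ≤ mu) (j : ℕ) :
    0 ≤ A j ∧ tau j = 1 + mu * A j ∧ 0 < a j ∧ tau j * A (j + 1) = 2 * L * a j ^ 2 := by
  obtain ⟨hA0, ht0, -, -, -, ha, hA, ht, -⟩ := H
  have key : ∀ j, 0 ≤ A j → tau j = 1 + mu * A j →
      0 < a j ∧ tau j * A (j + 1) = 2 * L * a j ^ 2 := by
    intro j h1 h2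
    have htp : 0 < tau j := by rw [h2]; positivity
    have h3 := root_eq (t := tau j) (A := A j) (K := 2 * L) (by linarith) htp.le h1
    have h4 : a j = (tau j + Real.sqrt (tau j ^ 2 + 4 * tau j * A j * (2 * L))) / (2 * (2 * L)) := by
      rw [ha j]; ring_nf
    rw [← h4] at h3
    refine ⟨?_, ?_⟩
    · rw [h4]; positivity
    · rw [hA, h3]
  have ind : 0 ≤ A j ∧ tau j = 1 + mu * A j := by
    induction j with
    | zero => simp [hA0, ht0]
    | succ j ih =>
      have := key j ih.1 ih.2
      rw [hA, ht, ih.2]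
      refine ⟨by linarith, by ring⟩
  exact ⟨ind.1, ind.2, key j ind.1 ind.2⟩

lemma acg_vec {domh : Set (Euc n)} {g h : Euc n → ℝ} {g' : Euc n → Euc n} {L mu : ℝ}
    {x0 : Euc n} {x y xt yt : ℕ → Euc n} {a A tau : ℕ → ℝ} {Th : ℕ → Euc n → ℝ}
    (H : ACGSpec domh g h g' L mu x0 x y xt yt a A tau)
    (HT : ThetaSpec g h g' L mu xt yt a A Th) (hL : 0 < L) (hmu : 0 ≤ mu)
    (hc : ConvexOn ℝ domh h)
    (hlow : ∀ x u, g x + ⟪g' x, u - x⟫ + mu / 2 * ‖u - x‖ ^ 2 ≤ g u)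
    (hup : ∀ x u, g u ≤ g x + ⟪g' x, u - x⟫ + (L + mu) / 2 * ‖u - x‖ ^ 2) (j : ℕ) :
    y j ∈ domh ∧ (∀ u ∈ domh, A j * Th j u ≤ A j * (g u + h u)) ∧
    (∀ u, A j * Th j u + ‖u - x0‖ ^ 2 / 2 =
      A j * Th j (x j) + ‖x j - x0‖ ^ 2 / 2 + tau j / 2 * ‖u - x j‖ ^ 2) ∧
    A j * (g (y j) + h (y j)) ≤ A j * Th j (x j) + ‖x j - x0‖ ^ 2 / 2 := by
  have hs := acg_scal H hL hmu
  obtain ⟨hA0, ht0, hx0, hy0, hx0m, ha, hA, ht, hxt, hytm, hopt, hy, hx⟩ := H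
  obtain ⟨hT0, hT⟩ := HT
  induction j with
  | zero => simp [hA0, ht0, hx0, hy0, hx0m]; intro u; ring
  | succ j ih =>
    obtain ⟨ih1, ih2, ih3, ih4⟩ := ih
    obtain ⟨s1, s2, s3, s4⟩ := hs j
    have hA1 : 0 < A (j + 1) := by rw [hA]; linarith
    have htp : 0 < tau j := by rw [s2]; positivity
    have htp1 : 0 < tau (j + 1) := by rw [ht]; positivity
    obtain ⟨hy1, hy2, hy3⟩ := hy j
    -- the model
    set p := (2 * L) • (xt j - yt (j + 1)) with hp
    set C := g (xt j) + ⟪g' (xt j), yt (j + 1) - xt j⟫ + h (yt (j + 1)) +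
          (2 * L + mu) / 2 * ‖yt (j + 1) - xt j‖ ^ 2 -
        L * ‖yt (j + 1) - xt j‖ ^ 2 with hC
    have hT' : ∀ u, A (j + 1) * Th (j + 1) u = A j * Th j u + a j *
        (C + ⟪p, u - yt (j + 1)⟫ + mu / 2 * ‖u - yt (j + 1)‖ ^ 2) := by
      intro u
      rw [hT j u, mul_div_cancel₀ _ hA1.ne']
    have hth : ∀ u ∈ domh, C + ⟪p, u - yt (j + 1)⟫ + mu / 2 * ‖u - yt (j + 1)‖ ^ 2 ≤ g u + h u := by
      intro u hu
      have h1 := prox_opt hc (q := g' (xt j)) (xt := xt j) (M := 2 * L + mu) (hytm j) hu (by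
        intro u hu
        have := hopt j u hu
        linarith)
      have h2 := hlow (xt j) u
      have e : u - xt j = (yt (j + 1) - xt j) + (u - yt (j + 1)) := by abel
      rw [e, norm_add_sq_real, inner_add_right] at h2
      have e2 : ⟪p, u - yt (j + 1)⟫ = - (2 * L) * ⟪yt (j + 1) - xt j, u - yt (j + 1)⟫ := by
        rw [hp, real_inner_smul_left, ← neg_sub (yt (j + 1)) (xt j), inner_neg_left]; ring
      rw [e2, hC]
      linarith
    have hxt' : A (j + 1) • xt j = A j • y j + a j • x j := by
      rw [hxt, smul_add, smul_smul, smul_smul, mul_div_cancel₀ _ hA1.ne', mul_div_cancel₀ _ hA1.ne']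
    have hx' : tau (j + 1) • x (j + 1) = tau j • x j + (a j * mu) • yt (j + 1) - a j • p := by
      have e1 : tau (j + 1) = A (j + 1) * mu + 1 := by rw [ht, s2, hA]; ring
      have e2 : xt j = (A j / A (j + 1)) • y j + (a j / A (j + 1)) • x j := hxt j
      have e3 : (2 * L * a j) * (a j / A (j + 1)) = tau j := by
        field_simp; linarith
      rw [hx, ← e1, smul_smul, mul_inv_cancel₀ htp1.ne', one_smul, hp, e2, ← e3]
      have e4 : 2 * A j * a j * L / A (j + 1) = 2 * L * a j * (A j / A (j + 1)) := by ring
      rw [e4]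
      module
    have hq := quad_min (t := tau j) (t' := tau (j + 1)) (a := a j) (mu := mu) (by rw [ht]; ring) hx'
    have h3 : ∀ u, A (j + 1) * Th (j + 1) u + ‖u - x0‖ ^ 2 / 2 =
        A j * Th j (x j) + ‖x j - x0‖ ^ 2 / 2 + a j * C + (tau j / 2 * ‖u - x j‖ ^ 2 +
          a j * (⟪p, u - yt (j + 1)⟫ + mu / 2 * ‖u - yt (j + 1)‖ ^ 2)) := by
      intro u
      rw [hT']
      linarith [ih3 u]
    refine ⟨?_, ?_, ?_, ?_⟩
    · rcases hy1 with h1 | h1 <;> rw [h1]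
      exacts [ih1, hytm j]
    · intro u hu
      rw [hT', hA]
      have := mul_le_mul_of_nonneg_left (hth u hu) s3.le
      linarith [ih2 u hu]
    · intro u
      rw [h3 u, h3 (x (j + 1)), hq u]; ring
    · rw [h3]
      have hst := step_est (A := A j) (a := a j) (A1 := A (j + 1)) (t := tau j) (K := 2 * L)
        (c := L * ‖yt (j + 1) - xt j‖ ^ 2) (y := y j) (x := x j) (xt := xt j) (p := p)
        (z := yt (j + 1)) (u := x (j + 1)) (hA j) hA1 s4 hxt' (by
          intro d
          have e : xt j + d - yt (j + 1) = (xt j - yt (j + 1)) + d := by abel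
          rw [e, hp, real_inner_smul_left, inner_add_right, real_inner_self_eq_norm_sq,
            norm_sub_rev (yt (j + 1))]
          have := norm_add_sq_real (xt j - yt (j + 1)) d
          nlinarith [sq_nonneg ‖xt j - yt (j + 1) + d‖])
      have h4 := mul_le_mul_of_nonneg_left (hth (y j) ih1) s1
      have h5 : 0 ≤ A j * (mu / 2 * ‖y j - yt (j + 1)‖ ^ 2) := by positivity
      have h5' : 0 ≤ a j * (mu / 2 * ‖x (j + 1) - yt (j + 1)‖ ^ 2) := by positivity
      have h6 := hup (xt j) (yt (j + 1))
      have h7 : g (y (j + 1)) + h (y (j + 1)) ≤ C + L * ‖yt (j + 1) - xt j‖ ^ 2 := by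
        have : 0 ≤ L / 2 * ‖yt (j + 1) - xt j‖ ^ 2 := by positivity
        rw [hC]; linarith
      have h8 := mul_le_mul_of_nonneg_left h7 hA1.le
      have h9 : A (j + 1) * C = A j * C + a j * C := by rw [hA]; ring
      linarith

/-- The restart criterion holds as soon as `A_j ≥ 8 lam / sigma`. -/
lemma acg_stop {domh : Set (Euc n)} {g h : Euc n → ℝ} {g' : Euc n → Euc n} {L mu : ℝ}
    {x0 : Euc n} {x y xt yt : ℕ → Euc n} {a A tau : ℕ → ℝ} {Th : ℕ → Euc n → ℝ}
    (H : ACGSpec domh g h g' L mu x0 x y xt yt a A tau)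
    (HT : ThetaSpec g h g' L mu xt yt a A Th) (hL : 0 < L) (hmu : 0 ≤ mu)
    (hc : ConvexOn ℝ domh h)
    (hlow : ∀ x u, g x + ⟪g' x, u - x⟫ + mu / 2 * ‖u - x‖ ^ 2 ≤ g u)
    (hup : ∀ x u, g u ≤ g x + ⟪g' x, u - x⟫ + (L + mu) / 2 * ‖u - x‖ ^ 2) (j : ℕ)
    {lam sigma : ℝ} (hlam : 0 < lam) (hs : 0 < sigma) (hs1 : sigma < 1)
    (hA : 8 * lam / sigma ≤ A j) :
    ‖lam • ((A j)⁻¹ • (x0 - x j))‖ ^ 2 + 2 * lam * ((g (y j) + h (y j)) - Th j (x j)) ≤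
      sigma * ‖y j - x0‖ ^ 2 := by
  obtain ⟨s1, s2, s3, s4⟩ := acg_scal H hL hmu j
  obtain ⟨v1, v2, v3, v4⟩ := acg_vec H HT hL hmu hc hlow hup j
  have hAp : 0 < A j := lt_of_lt_of_le (by positivity) hA
  have ht1 : 1 ≤ tau j := by rw [s2]; nlinarith
  set r := lam / A j with hr
  have hr0 : 0 < r := by positivity
  have hr1 : r ≤ sigma / 8 := by
    rw [hr, div_le_iff₀ hAp]
    rw [div_le_iff₀ hs] at hA
    linarith
  have h1 : ‖y j - x j‖ ^ 2 ≤ ‖y j - x0‖ ^ 2 := by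
    have := v3 (y j)
    have := v2 _ v1
    nlinarith [sq_nonneg ‖y j - x j‖]
  have h2 : ‖x j - x0‖ ^ 2 ≤ 4 * ‖y j - x0‖ ^ 2 := by
    have h3 : ‖y j - x j‖ ≤ ‖y j - x0‖ := (abs_le_of_sq_le_sq' h1 (norm_nonneg _)).2
    have h4 : ‖x j - x0‖ ≤ ‖y j - x j‖ + ‖y j - x0‖ := by
      rw [norm_sub_rev (y j) (x j)]
      simpa using norm_add_le (x j - y j) (y j - x0)
    nlinarith [norm_nonneg (x j - x0), norm_nonneg (y j - x0)]
  have e1 : ‖lam • ((A j)⁻¹ • (x0 - x j))‖ ^ 2 = r ^ 2 * ‖x j - x0‖ ^ 2 := by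
    rw [smul_smul, norm_smul, mul_pow, Real.norm_eq_abs, sq_abs, norm_sub_rev, hr, div_eq_mul_inv]
  have e2 : 2 * lam * ((g (y j) + h (y j)) - Th j (x j)) ≤ r * ‖x j - x0‖ ^ 2 := by
    have : 2 * lam * ((g (y j) + h (y j)) - Th j (x j)) =
      r * (2 * (A j * (g (y j) + h (y j)) - A j * Th j (x j))) := by
      rw [hr]; field_simp
    rw [this]
    apply mul_le_mul_of_nonneg_left _ hr0.le
    linarith
  rw [e1]
  have h5 : (r ^ 2 + r) * ‖x j - x0‖ ^ 2 ≤ (r ^ 2 + r) * (4 * ‖y j - x0‖ ^ 2) :=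
    mul_le_mul_of_nonneg_left h2 (by positivity)
  have h6 : (r ^ 2 + r) * 4 ≤ sigma := by nlinarith
  have h7 := mul_le_mul_of_nonneg_right h6 (sq_nonneg ‖y j - x0‖)
  linarith

/-- geometric growth -/
lemma geo_growth {A a t : ℕ → ℝ} {K mu rho : ℝ} (hK : 0 < K) (hrho : 0 ≤ rho)
    (hA0 : ∀ j, 0 ≤ A j) (ha : ∀ j, 0 < a j) (hA : ∀ j, A (j + 1) = A j + a j)
    (ht : ∀ j, t j = 1 + mu * A j) (hmu : 0 ≤ mu)
    (he : ∀ j, t j * A (j + 1) = K * a j ^ 2) (hr : K * rho ^ 2 ≤ mu) (h0 : A 0 = 0) (j : ℕ) :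
    1 / K * (1 + rho) ^ j ≤ A (j + 1) := by
  induction j with
  | zero =>
    have h1 := he 0
    rw [hA, ht, h0] at h1
    have h2 : K * a 0 = 1 := by
      have := ha 0
      have : a 0 * (K * a 0 - 1) = 0 := by linarith
      rcases mul_eq_zero.1 this with h | h <;> linarith
    have h3 : a 0 = 1 / K := by field_simp; linarith
    rw [hA, h0, h3]; simp
  | succ j ih =>
    have h1 := he (j + 1)
    have h3 := hA0 (j + 1)
    have h2 : rho * A (j + 1) ≤ a (j + 1) := by
      have h4 : K * (rho * A (j + 1)) ^ 2 ≤ K * a (j + 1) ^ 2 := by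
        rw [← h1, ht, hA (j + 1)]
        have h5 := mul_le_mul_of_nonneg_right hr (sq_nonneg (A (j + 1)))
        have := ha (j + 1)
        have : 0 ≤ mu * A (j + 1) * a (j + 1) := by positivity
        nlinarith
      have h5 := le_of_mul_le_mul_left h4 hK
      exact (abs_le_of_sq_le_sq' h5 (ha _).le).2
    rw [hA (j + 1), pow_succ]
    nlinarith

/-- quadratic growth -/
lemma quad_growth {A a t : ℕ → ℝ} {K mu : ℝ} (hK : 0 < K)
    (hA0 : ∀ j, 0 ≤ A j) (ha : ∀ j, 0 < a j) (hA : ∀ j, A (j + 1) = A j + a j)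
    (ht : ∀ j, t j = 1 + mu * A j) (hmu : 0 ≤ mu)
    (he : ∀ j, t j * A (j + 1) = K * a j ^ 2) (h0 : A 0 = 0) (j : ℕ) :
    (j : ℝ) ^ 2 ≤ 4 * K * A j := by
  induction j with
  | zero => simp [h0]
  | succ j ih =>
    have h1 := he j
    have h3 := hA0 j
    have h4 := ha j
    have h5 := hA j
    have h6 : A (j + 1) ≤ K * a j ^ 2 := by
      rw [← h1, ht]
      have := hA0 (j + 1)
      have : 0 ≤ mu * A j * A (j + 1) := by positivity
      nlinarith
    push_cast
    have hj : (0:ℝ) ≤ j := Nat.cast_nonneg j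
    have hKA : 0 ≤ K * A (j + 1) := mul_nonneg hK.le (hA0 _)
    -- `j + 1 / 2 ≤ ...`
    have h7 : (j : ℝ) ≤ 2 * (K * a j) := by
      have : (j : ℝ) ^ 2 ≤ (2 * (K * a j)) ^ 2 := by
        have := mul_le_mul_of_nonneg_left h6 hK.le
        have : K * A j ≤ K * A (j + 1) := by apply mul_le_mul_of_nonneg_left _ hK.le; linarith
        nlinarith
      exact (abs_le_of_sq_le_sq' this (by positivity)).2
    have h8 : 1 ≤ K * a j := by
      have : a j * 1 ≤ a j * (K * a j) := by nlinarith
      exact le_of_mul_le_mul_left this h4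
    rw [hA]
    nlinarith

lemma log_half {x : ℝ} (h0 : 0 ≤ x) (h1 : x ≤ 1) : x / 2 ≤ Real.log (1 + x) := by
  have := Real.one_sub_inv_le_log_of_pos (show 0 < 1 + x by linarith)
  have h2 : 1 - (1 + x)⁻¹ = x / (1 + x) := by field_simp; ring
  rw [h2] at this
  refine le_trans ?_ this
  apply div_le_div_of_nonneg_left h0 <;> linarith

lemma g_low {f : Euc n → ℝ} {f' : Euc n → Euc n} {mu lam : ℝ} (hsc : SCOn Set.univ mu f)
    (hf : ∀ x, HasGradientAt f (f' x) x) (hlam : 0 < lam) (v x u : Euc n) :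
    (f x + ‖x - v‖ ^ 2 / (2 * lam)) + ⟪f' x + lam⁻¹ • (x - v), u - x⟫ +
      (mu + 1 / lam) / 2 * ‖u - x‖ ^ 2 ≤ f u + ‖u - v‖ ^ 2 / (2 * lam) := by
  have h := grad_lower hsc hf x u
  have e : u - v = (x - v) + (u - x) := by abel
  rw [e, norm_add_sq_real, inner_add_left, real_inner_smul_left]
  have e2 : (‖x - v‖ ^ 2 + 2 * ⟪x - v, u - x⟫ + ‖u - x‖ ^ 2) / (2 * lam) =
    ‖x - v‖ ^ 2 / (2 * lam) + lam⁻¹ * ⟪x - v, u - x⟫ + 1 / lam / 2 * ‖u - x‖ ^ 2 := by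
    field_simp
  rw [e2]
  linarith

lemma g_up {f : Euc n → ℝ} {f' : Euc n → Euc n} {mu lam L : ℝ} (hf : HasLipGrad f f' L)
    (hlam : 0 < lam) (v x u : Euc n) :
    f u + ‖u - v‖ ^ 2 / (2 * lam) ≤ (f x + ‖x - v‖ ^ 2 / (2 * lam)) +
      ⟪f' x + lam⁻¹ • (x - v), u - x⟫ + (L - mu + (mu + 1 / lam)) / 2 * ‖u - x‖ ^ 2 := by
  have h := grad_upper hf x u
  have e : u - v = (x - v) + (u - x) := by abel
  rw [e, norm_add_sq_real, inner_add_left, real_inner_smul_left]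
  have e2 : (‖x - v‖ ^ 2 + 2 * ⟪x - v, u - x⟫ + ‖u - x‖ ^ 2) / (2 * lam) =
    ‖x - v‖ ^ 2 / (2 * lam) + lam⁻¹ * ⟪x - v, u - x⟫ + 1 / lam / 2 * ‖u - x‖ ^ 2 := by
    field_simp
  rw [e2]
  linarith

/-- bound from geometric growth -/
lemma inner_count {domh : Set (Euc n)} {g h : Euc n → ℝ} {g' : Euc n → Euc n} {L mu : ℝ}
    {x0 : Euc n} {x y xt yt : ℕ → Euc n} {a A tau : ℕ → ℝ}
    (H : ACGSpec domh g h g' L mu x0 x y xt yt a A tau) (hL : 0 < L)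
    {lam sigma : ℝ} (hlam : 0 < lam) (hs : 0 < sigma) (hs1 : sigma < 1) (hmu : 1 / lam ≤ mu)
    (hlL : 1 ≤ lam * L) (J : ℕ)
    (hJ : ∀ j, 1 ≤ j → j < J → A j < 8 * lam / sigma) :
    (J : ℝ) ≤ 14 * Real.sqrt (lam * L) * (1 + Real.log (sigma⁻¹ * lam * L)) := by
  have hmu0 : 0 ≤ mu := le_trans (by positivity) hmu
  set N := Real.sqrt (lam * L) with hN
  have hN1 : 1 ≤ N := by rw [hN, Real.one_le_sqrt]; exact hlL
  have hN2 : N ^ 2 = lam * L := Real.sq_sqrt (by linarith)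
  have hz : 1 ≤ sigma⁻¹ * lam * L := by
    have : 1 ≤ sigma⁻¹ := (one_le_inv₀ hs).2 hs1.le
    nlinarith
  have hl : 0 ≤ Real.log (sigma⁻¹ * lam * L) := Real.log_nonneg hz
  set l := Real.log (sigma⁻¹ * lam * L) with hldef
  rcases Nat.lt_or_ge J 2 with h2 | h2
  · have : (J : ℝ) ≤ 1 := by exact_mod_cast Nat.lt_succ_iff.1 h2
    nlinarith
  obtain ⟨m, rfl⟩ := Nat.exists_eq_add_of_le h2
  have hj := hJ (m + 1) (by omega) (by omega)
  have hsc := acg_scal H hL hmu0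
  set rho := 1 / (2 * N) with hrho
  have hr0 : 0 < rho := by positivity
  have hr1 : rho ≤ 1 := by rw [hrho, div_le_one (by linarith)]; linarith
  have hg := geo_growth (A := A) (a := a) (t := tau) (K := 2 * L) (mu := mu) (rho := rho)
    (by linarith) hr0.le (fun j => (hsc j).1) (fun j => (hsc j).2.2.1) H.2.2.2.2.2.2.1
    (fun j => (hsc j).2.1) hmu0 (fun j => (hsc j).2.2.2) (by
      refine le_trans ?_ hmu
      rw [hrho, div_pow, mul_pow, hN2]
      have : 2 * L * (1 ^ 2 / (2 ^ 2 * (lam * L))) = 1 / lam / 2 := by field_simp; try norm_num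
      rw [this]
      have : 0 < 1 / lam := by positivity
      linarith) H.1 m
  have h3 : (1 + rho) ^ m ≤ 16 * (sigma⁻¹ * lam * L) := by
    have h4 := hg.trans hj.le
    rw [one_div, inv_mul_le_iff₀ (by linarith)] at h4
    refine h4.trans (le_of_eq ?_)
    field_simp; try norm_num
  have h5 := Real.log_le_log (by positivity) h3
  rw [Real.log_pow, Real.log_mul (by norm_num) (by linarith)] at h5
  have h16 : Real.log 16 ≤ 3 := by
    have : (16:ℝ) = 2 ^ 4 := by norm_num
    rw [this, Real.log_pow]
    have := Real.log_two_lt_d9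
    push_cast; linarith
  have h6 := mul_le_mul_of_nonneg_left (log_half hr0.le hr1) (Nat.cast_nonneg (α := ℝ) m)
  have h7 : (m : ℝ) * (rho / 2) ≤ 3 + l := by linarith
  have h8 : (m : ℝ) ≤ 4 * N * (3 + l) := by
    have : (m : ℝ) * (rho / 2) = m / (4 * N) := by rw [hrho]; field_simp; try norm_num
    rw [this, div_le_iff₀ (by positivity)] at h7
    linarith
  push_cast
  have : 0 ≤ N * l := by positivity
  linarith

lemma outer_main {domh : Set (Euc n)} {f h : Euc n → ℝ} {f' : Euc n → Euc n}
    {muf Lf lam sigma : ℝ}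
    (hmu : 0 ≤ muf) (hL : 0 < Lf - muf) (hs : 0 < sigma) (hs1 : sigma < 1) (hlam : 0 < lam)
    (hsc : SCOn Set.univ muf f) (hf : HasLipGrad f f' Lf) (hc : ConvexOn ℝ domh h)
    {w v vt : ℕ → Euc n} {bo Bo tauo : ℕ → ℝ}
    {xin yin xtin ytin : ℕ → ℕ → Euc n} {ain Ain tauin : ℕ → ℕ → ℝ}
    {Thin : ℕ → ℕ → Euc n → ℝ} {J : ℕ → ℕ}
    (H : RestartSpec domh f h f' muf Lf lam sigma w v vt bo Bo tauo
            xin yin xtin ytin ain Ain tauin Thin J)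
    {u : Euc n} (hu : u ∈ domh) (k : ℕ) :
    0 ≤ Bo k ∧ tauo k = 1 + muf * Bo k ∧ 0 < bo k ∧ tauo k * Bo (k + 1) = lam⁻¹ * bo k ^ 2 ∧
    w k ∈ domh ∧
    Bo k * (f (w k) + h (w k)) + tauo k / 2 * ‖u - v k‖ ^ 2 ≤
      Bo k * (f u + h u) + ‖u - w 0‖ ^ 2 / 2 := by
  obtain ⟨hB0, ht0, hv0, hw0, hb, hB, ht, hvt, hacg, hth, hJ1, hres, hw, hv⟩ := H
  have key : ∀ j, 0 ≤ Bo j → tauo j = 1 + muf * Bo j →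
      0 < bo j ∧ tauo j * Bo (j + 1) = lam⁻¹ * bo j ^ 2 := by
    intro j h1 h2
    have htp : 0 < tauo j := by rw [h2]; positivity
    refine ⟨by rw [hb]; positivity, ?_⟩
    rw [hB, hb]
    have h := Real.sq_sqrt (show 0 ≤ tauo j ^ 2 * lam ^ 2 + 4 * tauo j * lam * Bo j by positivity)
    set s := Real.sqrt (tauo j ^ 2 * lam ^ 2 + 4 * tauo j * lam * Bo j)
    field_simp
    nlinarith
  induction k with
  | zero =>
    have h1 : 0 ≤ Bo 0 := by rw [hB0]
    have h2 : tauo 0 = 1 + muf * Bo 0 := by rw [hB0, ht0]; ring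
    refine ⟨h1, h2, (key 0 h1 h2).1, (key 0 h1 h2).2, hw0, ?_⟩
    rw [hB0, ht0, hv0]; linarith
  | succ k ih =>
    obtain ⟨i1, i2, i3, i4, i5, i6⟩ := ih
    have j1 : 0 ≤ Bo (k + 1) := by rw [hB]; linarith
    have j1' : 0 < Bo (k + 1) := by rw [hB]; linarith
    have j2 : tauo (k + 1) = 1 + muf * Bo (k + 1) := by rw [ht, hB, i2]; ring
    have htp : 0 < tauo (k + 1) := by rw [j2]; positivity
    have hmu' : 0 ≤ muf + 1 / lam := by positivity
    have hV := acg_vec (hacg k) (hth k) hL hmu' hc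
      (fun x u => g_low hsc hf.1 hlam (vt k) x u) (fun x u => g_up hf hlam (vt k) x u) (J k)
    obtain ⟨a1, a2, -, -⟩ := acg_scal (hacg k) hL hmu' (J k)
    have hApos : 0 < Ain k (J k) := by
      obtain ⟨m, hm⟩ := Nat.exists_eq_add_of_le (hJ1 k)
      obtain ⟨b1, -, b3, -⟩ := acg_scal (hacg k) hL hmu' m
      rw [hm, add_comm, (hacg k).2.2.2.2.2.2.1 m]; linarith
    obtain ⟨v1, v2, v3, -⟩ := hV
    have hr := hres k
    have hvk := hv k
    obtain ⟨w1, w2, w3⟩ := hw k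
    set A := Ain k (J k) with hAd
    set x := xin k (J k) with hxd
    set y := yin k (J k) with hyd
    set T := Thin k (J k) x with hTd
    set s := A⁻¹ • (vt k - x) with hsd
    have hAs : vt k - x = A • s := by rw [hsd, smul_smul, mul_inv_cancel₀ hApos.ne', one_smul]
    set p := ((A + lam) / lam) • s with hpd
    set Q := T - ‖x - vt k‖ ^ 2 / (2 * lam) with hQd
    -- lower model of the objective
    have hq : ∀ u ∈ domh, Q + ⟪p, u - x⟫ + muf / 2 * ‖u - x‖ ^ 2 ≤ f u + h u := by
      intro u hu
      have h1 := v2 u hu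
      have h2 := v3 u
      have h3 : Thin k (J k) u = T + ⟪s, u - x⟫ + (muf + 1 / lam) / 2 * ‖u - x‖ ^ 2 := by
        have e : u - vt k = (u - x) - A • s := by rw [← hAs]; abel
        have e' : x - vt k = - (A • s) := by rw [← hAs]; abel
        rw [e, e', norm_sub_sq_real, norm_neg, real_inner_smul_right, a2, real_inner_comm] at h2
        have : A * Thin k (J k) u = A * (T + ⟪s, u - x⟫ + (muf + 1 / lam) / 2 * ‖u - x‖ ^ 2) := by
          linarith
        exact mul_left_cancel₀ hApos.ne' this
      have h4 := le_of_mul_le_mul_left h1 hApos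
      rw [h3] at h4
      have e : u - vt k = (u - x) + (x - vt k) := by abel
      have e' : x - vt k = - (A • s) := by rw [← hAs]; abel
      have e3 : ‖u - vt k‖ ^ 2 = ‖u - x‖ ^ 2 - 2 * (A * ⟪s, u - x⟫) + ‖x - vt k‖ ^ 2 := by
        rw [e, norm_add_sq_real, e', inner_neg_right, real_inner_smul_right, real_inner_comm]; ring
      have e4 : ⟪p, u - x⟫ = ⟪s, u - x⟫ + A / lam * ⟪s, u - x⟫ := by
        rw [hpd, real_inner_smul_left]; field_simp; ring
      rw [e3] at h4
      have e5 : (‖u - x‖ ^ 2 - 2 * (A * ⟪s, u - x⟫) + ‖x - vt k‖ ^ 2) / (2 * lam) =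
        1 / lam / 2 * ‖u - x‖ ^ 2 - A / lam * ⟪s, u - x⟫ + ‖x - vt k‖ ^ 2 / (2 * lam) := by
        field_simp
      rw [e5] at h4
      rw [hQd, e4]
      linarith
    have hvt' : Bo (k + 1) • vt k = Bo k • w k + bo k • v k := by
      rw [hvt, smul_add, smul_smul, smul_smul, mul_div_cancel₀ _ j1'.ne', mul_div_cancel₀ _ j1'.ne']
    have hv' : tauo (k + 1) • v (k + 1) = tauo k • v k + (bo k * muf) • x - bo k • p := by
      have e : bo k • p = (bo k * (A + lam) / lam) • s := by
        rw [hpd, smul_smul (bo k), mul_div_assoc]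
      rw [e, hvk, smul_smul (tauo (k + 1)), mul_inv_cancel₀ htp.ne', one_smul]
    have hqm := quad_min (ht k) hv' u
    have hst := step_est (A := Bo k) (a := bo k) (A1 := Bo (k + 1)) (t := tauo k) (K := lam⁻¹)
        (c := f y + h y - Q) (y := w k) (x := v k) (xt := vt k) (p := p)
        (z := x) (u := v (k + 1)) (hB k) j1' i4 hvt' (by
          intro d
          have e : vt k + d - x = A • s + d := by rw [← hAs]; abel
          have e' : x - vt k = - (A • s) := by rw [← hAs]; abel
          rw [hQd, e, e', norm_neg, hpd, real_inner_smul_left, inner_add_right, real_inner_smul_right,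
            real_inner_self_eq_norm_sq, norm_smul, mul_pow, Real.norm_eq_abs, sq_abs]
          rw [norm_smul, mul_pow, Real.norm_eq_abs, sq_abs] at hr
          have h1 := sq_nonneg ‖(A + lam) • s + d‖
          rw [norm_add_sq_real, real_inner_smul_left, norm_smul, mul_pow, Real.norm_eq_abs, sq_abs] at h1
          have h2 : 0 ≤ (1 - sigma) * ‖y - vt k‖ ^ 2 :=
            mul_nonneg (by linarith) (sq_nonneg _)
          have e6 : 2 * lam * (f y + ‖y - vt k‖ ^ 2 / (2 * lam) + h y - T) =
            2 * lam * (f y + h y - T) + ‖y - vt k‖ ^ 2 := by field_simp; ring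
          rw [e6] at hr
          have h3 : 2 * lam * (f y + h y - (T - A ^ 2 * ‖s‖ ^ 2 / (2 * lam))) ≤
            2 * lam * ((A + lam) / lam * (A * ‖s‖ ^ 2 + ⟪s, d⟫) + lam⁻¹ / 2 * ‖d‖ ^ 2) := by
            have e7 : 2 * lam * (f y + h y - (T - A ^ 2 * ‖s‖ ^ 2 / (2 * lam))) =
              2 * lam * (f y + h y - T) + A ^ 2 * ‖s‖ ^ 2 := by field_simp; ring
            have e8 : 2 * lam * ((A + lam) / lam * (A * ‖s‖ ^ 2 + ⟪s, d⟫) + lam⁻¹ / 2 * ‖d‖ ^ 2) =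
              2 * (A + lam) * (A * ‖s‖ ^ 2 + ⟪s, d⟫) + ‖d‖ ^ 2 := by field_simp
            rw [e7, e8]
            linarith
          exact le_of_mul_le_mul_left h3 (by linarith))
    refine ⟨j1, j2, (key _ j1 j2).1, (key _ j1 j2).2, ?_, ?_⟩
    · rcases w1 with h1 | h1 <;> rw [h1]
      exacts [i5, v1]
    · have h1 := mul_le_mul_of_nonneg_left (hq (w k) i5) i1
      have h2 := mul_le_mul_of_nonneg_left (hq u hu) i3.le
      have h3 := mul_le_mul_of_nonneg_left w3 j1
      have h4 : 0 ≤ Bo k * (muf / 2 * ‖w k - x‖ ^ 2) := by positivity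
      have h5 : 0 ≤ bo k * (muf / 2 * ‖v (k + 1) - x‖ ^ 2) := by positivity
      have e1 : Bo (k + 1) * Q = Bo k * Q + bo k * Q := by rw [hB]; ring
      have e2 : Bo (k + 1) * (f u + h u) = Bo k * (f u + h u) + bo k * (f u + h u) := by rw [hB]; ring
      linarith

lemma sum_bound {J : ℕ → ℕ} {K : ℕ} {D M : ℝ} (hJ : ∀ k, (J k : ℝ) ≤ D) (hD : 0 ≤ D)
    (hK : (K : ℝ) ≤ M) : ∑ k ∈ Finset.range K, (J k : ℝ) ≤ M * D := by
  calc ∑ k ∈ Finset.range K, (J k : ℝ) ≤ ∑ k ∈ Finset.range K, D := Finset.sum_le_sum fun k _ => hJ k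
    _ = K * D := by simp
    _ ≤ M * D := mul_le_mul_of_nonneg_right hK hD

lemma final_num {muf Lf lam sigma eps R0 : ℝ} {bo Bo tauo : ℕ → ℝ} {J : ℕ → ℕ}
    (hmu : 0 ≤ muf) (hL : 0 < Lf - muf) (hs : 0 < sigma) (hs1 : sigma < 1) (hlam : 0 < lam)
    (heps : 0 < eps) (hB : ∀ k, Bo (k + 1) = Bo k + bo k) (hBn : ∀ k, 0 ≤ Bo k)
    (ht : ∀ k, tauo k = 1 + muf * Bo k) (hb : ∀ k, 0 < bo k)
    (he : ∀ k, tauo k * Bo (k + 1) = lam⁻¹ * bo k ^ 2) (hB0 : Bo 0 = 0) (hR : 0 ≤ R0)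
    (gap : ℕ → ℝ) (hgap : ∀ k, Bo k * gap k ≤ R0 ^ 2 / 2)
    (hcount : 1 ≤ lam * (Lf - muf) → ∀ k, (J k : ℝ) ≤
      14 * Real.sqrt (lam * (Lf - muf)) * (1 + Real.log (sigma⁻¹ * lam * (Lf - muf)))) :
    ((muf = 0 ∧ 1 / Lf ≤ lam ∧ lam ≤ R0 ^ 2 / eps) →
          ∃ K : ℕ, gap K ≤ eps ∧
            (∑ k ∈ Finset.range K, (J k : ℝ)) ≤
              42 * (1 + Real.log (sigma⁻¹ * lam * Lf)) ^ (42 : ℝ) *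
                (1 + R0 * Real.sqrt (Lf / eps))) ∧
        ((0 < muf ∧ 1 / (Lf - muf) ≤ lam ∧ lam ≤ min (1 / muf) (R0 ^ 2 / eps)) →
          ∃ K : ℕ, gap K ≤ eps ∧
            (∑ k ∈ Finset.range K, (J k : ℝ)) ≤
              42 * (1 + Real.log (sigma⁻¹ * lam * (Lf - muf)) +
                  Real.log (R0 ^ 2 / (lam * eps) + 1) +
                  Real.log (1 / (lam * muf) + 1)) ^ (42 : ℝ) *
                (1 + min (Real.sqrt (Lf / muf)) (R0 * Real.sqrt (Lf / eps)))) := by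
  have hLle : Lf - muf ≤ Lf := by linarith
  set l1 := Real.log (sigma⁻¹ * lam * (Lf - muf)) with hl1d
  have hl1 : 1 ≤ lam * (Lf - muf) → 0 ≤ l1 := by
    intro hlL
    apply Real.log_nonneg
    have : 1 ≤ sigma⁻¹ := (one_le_inv₀ hs).2 hs1.le
    nlinarith
  have hgap' : ∀ k, R0 ^ 2 / eps / 2 ≤ Bo k → 0 < Bo k → gap k ≤ eps := by
    intro k hk hk0
    have h1 := hgap k
    have h2 : R0 ^ 2 / 2 ≤ Bo k * eps := by
      have := mul_le_mul_of_nonneg_right hk heps.le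
      have e : R0 ^ 2 / eps / 2 * eps = R0 ^ 2 / 2 := by field_simp
      linarith
    exact le_of_mul_le_mul_left (h1.trans h2) hk0
  have optA : 1 ≤ lam * (Lf - muf) → lam ≤ R0 ^ 2 / eps → ∃ K : ℕ, gap K ≤ eps ∧
      (∑ k ∈ Finset.range K, (J k : ℝ)) ≤ 42 * (1 + l1) * (R0 * Real.sqrt (Lf / eps)) := by
    intro hlL hle
    have hl := hl1 hlL
    have hle' : lam * eps ≤ R0 ^ 2 := by rwa [le_div_iff₀ heps] at hle
    have hq : 0 < Real.sqrt (lam * eps) := Real.sqrt_pos.2 (by positivity)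
    have hq2 : Real.sqrt (lam * eps) ^ 2 = lam * eps := Real.sq_sqrt (by positivity)
    set q := Real.sqrt (lam * eps) with hqd
    have hr1 : 1 ≤ R0 / q := by
      rw [le_div_iff₀ hq, one_mul, hqd]
      exact Real.sqrt_le_iff.2 ⟨hR, hle'⟩
    set r := R0 / q with hr
    have hK1 : 2 * r ≤ (⌈2 * r⌉₊ : ℝ) := Nat.le_ceil _
    have hK2 : (⌈2 * r⌉₊ : ℝ) < 2 * r + 1 := Nat.ceil_lt_add_one (by linarith)
    refine ⟨⌈2 * r⌉₊, ?_, ?_⟩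
    · have hg := quad_growth (A := Bo) (a := bo) (t := tauo) (K := lam⁻¹) (mu := muf)
        (by positivity) hBn hb hB ht hmu he hB0 ⌈2 * r⌉₊
      have h1 : (2 * r) ^ 2 ≤ 4 * lam⁻¹ * Bo ⌈2 * r⌉₊ := by
        refine le_trans ?_ hg
        nlinarith
      have h2 : lam * r ^ 2 = R0 ^ 2 / eps := by
        rw [hr, div_pow, hq2]; field_simp
      have h3 : lam * r ^ 2 ≤ Bo ⌈2 * r⌉₊ := by
        have := mul_le_mul_of_nonneg_left h1 hlam.le
        have e : lam * (4 * lam⁻¹ * Bo ⌈2 * r⌉₊) = 4 * Bo ⌈2 * r⌉₊ := by field_simp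
        rw [e] at this
        linarith
      have h4 : 0 < lam * r ^ 2 := by positivity
      apply hgap' <;> linarith
    · have h1 := sum_bound (hcount hlL) (by positivity) (show (⌈2 * r⌉₊ : ℝ) ≤ 3 * r by linarith)
      have h2 : r * Real.sqrt (lam * (Lf - muf)) ≤ R0 * Real.sqrt (Lf / eps) := by
        have e : r * Real.sqrt (lam * (Lf - muf)) = R0 * Real.sqrt ((Lf - muf) / eps) := by
          rw [hr, hqd, div_mul_eq_mul_div, mul_div_assoc, ← Real.sqrt_div (by positivity)]
          congr 2
          field_simp
        rw [e]
        gcongr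
      have h3 := mul_le_mul_of_nonneg_left h2 (show 0 ≤ 42 * (1 + l1) by linarith)
      linarith
  have optB : 0 < muf → 1 ≤ lam * (Lf - muf) → lam ≤ 1 / muf → ∃ K : ℕ, gap K ≤ eps ∧
      (∑ k ∈ Finset.range K, (J k : ℝ)) ≤
        28 * ((1 + l1) * (1 + Real.log (R0 ^ 2 / (lam * eps) + 1))) * Real.sqrt (Lf / muf) := by
    intro hmup hlL hle
    have hl := hl1 hlL
    have hle' : lam * muf ≤ 1 := by rwa [le_div_iff₀ hmup] at hle
    have hz : 1 ≤ R0 ^ 2 / (lam * eps) + 1 := by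
      have : 0 ≤ R0 ^ 2 / (lam * eps) := by positivity
      linarith
    have hl2 : 0 ≤ Real.log (R0 ^ 2 / (lam * eps) + 1) := Real.log_nonneg hz
    set l2 := Real.log (R0 ^ 2 / (lam * eps) + 1) with hl2d
    have hx : 0 < Real.sqrt (lam * muf) := Real.sqrt_pos.2 (by positivity)
    have hx1 : Real.sqrt (lam * muf) ≤ 1 := Real.sqrt_le_iff.2 ⟨zero_le_one, by rw [one_pow]; exact hle'⟩
    have hx2 : Real.sqrt (lam * muf) ^ 2 = lam * muf := Real.sq_sqrt (by positivity)
    set x := Real.sqrt (lam * muf) with hxd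
    set m := ⌈2 * l2 / x⌉₊ with hm
    have hm1 : 2 * l2 / x ≤ (m : ℝ) := Nat.le_ceil _
    have hm2 : (m : ℝ) < 2 * l2 / x + 1 := Nat.ceil_lt_add_one (by positivity)
    refine ⟨m + 1, ?_, ?_⟩
    · have hg := geo_growth (A := Bo) (a := bo) (t := tauo) (K := lam⁻¹) (mu := muf) (rho := x)
        (by positivity) hx.le hBn hb hB ht hmu he (by rw [hx2]; field_simp; exact le_rfl) hB0 m
      rw [one_div, inv_inv] at hg
      have h1 : R0 ^ 2 / (lam * eps) + 1 ≤ (1 + x) ^ m := by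
        rw [← Real.log_le_log_iff (by linarith) (by positivity), Real.log_pow]
        have h2 := mul_le_mul_of_nonneg_left (log_half hx.le hx1) (Nat.cast_nonneg (α := ℝ) m)
        rw [div_le_iff₀ hx] at hm1
        linarith
      have h3 := mul_le_mul_of_nonneg_left h1 hlam.le
      have e : lam * (R0 ^ 2 / (lam * eps) + 1) = R0 ^ 2 / eps + lam := by field_simp
      have h4 : 0 ≤ R0 ^ 2 / eps := by positivity
      apply hgap' <;> linarith
    · have hK : ((m + 1 : ℕ) : ℝ) ≤ 2 * (1 + l2) / x := by
        have e : 2 * (1 + l2) / x = 2 * l2 / x + 2 * (1 / x) := by ring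
        have : 1 ≤ 1 / x := by rw [le_div_iff₀ hx]; linarith
        push_cast
        linarith
      have h1 := sum_bound (hcount hlL) (by positivity) hK
      have h2 : Real.sqrt (lam * (Lf - muf)) / x ≤ Real.sqrt (Lf / muf) := by
        rw [hxd, ← Real.sqrt_div (by positivity)]
        apply Real.sqrt_le_sqrt
        rw [mul_div_mul_left _ _ hlam.ne']
        gcongr
      have h3 := mul_le_mul_of_nonneg_left h2
        (show 0 ≤ 28 * ((1 + l1) * (1 + l2)) by positivity)
      have e : 2 * (1 + l2) / x * (14 * Real.sqrt (lam * (Lf - muf)) * (1 + l1)) =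
        28 * ((1 + l1) * (1 + l2)) * (Real.sqrt (lam * (Lf - muf)) / x) := by ring
      linarith
  have pow_one_le : ∀ b : ℝ, 1 ≤ b → b ≤ b ^ (42 : ℝ) := by
    intro b hb
    exact Real.self_le_rpow_of_one_le hb (by norm_num)
  have two_pow : ∀ b : ℝ, 1 ≤ b → b * b ≤ b ^ (42 : ℝ) := by
    intro b hb
    have := Real.rpow_le_rpow_of_exponent_le hb (show (2:ℝ) ≤ 42 by norm_num)
    rw [Real.rpow_two, pow_two] at this
    exact this
  constructor
  · rintro ⟨h0, h1, h2⟩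
    have e : Lf - muf = Lf := by rw [h0]; ring
    have hLf : 0 < Lf := by linarith
    have hlL : 1 ≤ lam * (Lf - muf) := by rw [e]; rwa [div_le_iff₀ hLf] at h1
    obtain ⟨K, hK1, hK2⟩ := optA hlL h2
    refine ⟨K, hK1, hK2.trans ?_⟩
    have e2 : Real.log (sigma⁻¹ * lam * Lf) = l1 := by rw [hl1d, e]
    rw [e2]
    have hl := hl1 hlL
    have h3 := pow_one_le (1 + l1) (by linarith)
    have h4 : 0 ≤ R0 * Real.sqrt (Lf / eps) := by positivity
    generalize (1 + l1) ^ (42 : ℝ) = P at h3 ⊢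
    apply mul_le_mul _ _ h4 _ <;> linarith
  · rintro ⟨h0, h1, h2⟩
    have hlL : 1 ≤ lam * (Lf - muf) := by rwa [div_le_iff₀ hL] at h1
    have hl := hl1 hlL
    have hl2 : 0 ≤ Real.log (R0 ^ 2 / (lam * eps) + 1) := by
      apply Real.log_nonneg
      have : 0 ≤ R0 ^ 2 / (lam * eps) := by positivity
      linarith
    have hl3 : 0 ≤ Real.log (1 / (lam * muf) + 1) := by
      apply Real.log_nonneg
      have : 0 ≤ 1 / (lam * muf) := by positivity
      linarith
    set l2 := Real.log (R0 ^ 2 / (lam * eps) + 1)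
    set l3 := Real.log (1 / (lam * muf) + 1)
    have hb1 : 1 ≤ 1 + l1 + l2 + l3 := by linarith
    have h3 := pow_one_le (1 + l1 + l2 + l3) hb1
    have h3' := two_pow (1 + l1 + l2 + l3) hb1
    generalize (1 + l1 + l2 + l3) ^ (42 : ℝ) = P at h3 h3' ⊢
    have h5 : (1 + l1) * (1 + l2) ≤ (1 + l1 + l2 + l3) * (1 + l1 + l2 + l3) := by
      apply mul_le_mul <;> linarith
    rcases le_total (Real.sqrt (Lf / muf)) (R0 * Real.sqrt (Lf / eps)) with hc | hc
    · obtain ⟨K, hK1, hK2⟩ := optB h0 hlL (h2.trans (min_le_left _ _))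
      refine ⟨K, hK1, hK2.trans ?_⟩
      rw [min_eq_left hc]
      apply mul_le_mul _ _ (Real.sqrt_nonneg _) _ <;> linarith
    · obtain ⟨K, hK1, hK2⟩ := optA hlL (h2.trans (min_le_right _ _))
      refine ⟨K, hK1, hK2.trans ?_⟩
      rw [min_eq_right hc]
      have h4 : 0 ≤ R0 * Real.sqrt (Lf / eps) := by positivity
      apply mul_le_mul _ _ h4 _ <;> linarith

theorem restarted_acg_total_complexity :
    ∃ c : ℝ, 0 < c ∧
      ∀ (n : ℕ) (domh : Set (Euc n)) (f h : Euc n → ℝ) (f' : Euc n → Euc n)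
        (muf Lf lam sigma eps : ℝ)
        (_ : 0 < Lf) (_ : 0 ≤ muf) (_ : 2 * muf ≤ Lf)
        (_ : 0 < sigma) (_ : sigma < 1) (_ : 0 < lam) (_ : 0 < eps)
        (_ : SCOn Set.univ muf f) (_ : HasLipGrad f f' Lf)
        (_ : LowerSemicontinuous f)
        (_ : ConvexOn ℝ domh h) (_ : IsClosed domh)
        (_ : LowerSemicontinuousOn h domh) (_ : domh.Nonempty)
        (w v vt : ℕ → Euc n) (bo Bo tauo : ℕ → ℝ)
        (xin yin xtin ytin : ℕ → ℕ → Euc n) (ain Ain tauin : ℕ → ℕ → ℝ)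
        (Thin : ℕ → ℕ → Euc n → ℝ) (J : ℕ → ℕ)
        (_ : RestartSpec domh f h f' muf Lf lam sigma w v vt bo Bo tauo
            xin yin xtin ytin ain Ain tauin Thin J)
        -- each inner call is stopped at the FIRST iteration satisfying the restart condition
        (_ : ∀ k j, 1 ≤ j → j < J k →
          ¬(‖lam • ((Ain k j)⁻¹ • (vt k - xin k j))‖ ^ 2 +
              2 * lam * ((f (yin k j) + ‖yin k j - vt k‖ ^ 2 / (2 * lam) +
                  h (yin k j)) - Thin k j (xin k j)) ≤
            sigma * ‖yin k j - vt k‖ ^ 2))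
        (xstar : Euc n) (R0 : ℝ)
        (_ : xstar ∈ domh)
        (_ : ∀ u ∈ domh, f xstar + h xstar ≤ f u + h u)
        (_ : R0 = ‖w 0 - xstar‖)
        (_ : ∀ z ∈ domh, (∀ u ∈ domh, f z + h z ≤ f u + h u) → R0 ≤ ‖w 0 - z‖),
        -- (a) the convex case
        ((muf = 0 ∧ 1 / Lf ≤ lam ∧ lam ≤ R0 ^ 2 / eps) →
          ∃ K : ℕ,
            f (w K) + h (w K) - (f xstar + h xstar) ≤ eps ∧
            (∑ k ∈ Finset.range K, (J k : ℝ)) ≤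
              c * (1 + Real.log (sigma⁻¹ * lam * Lf)) ^ c *
                (1 + R0 * Real.sqrt (Lf / eps))) ∧
        -- (b) the strongly convex case
        ((0 < muf ∧ 1 / (Lf - muf) ≤ lam ∧ lam ≤ min (1 / muf) (R0 ^ 2 / eps)) →
          ∃ K : ℕ,
            f (w K) + h (w K) - (f xstar + h xstar) ≤ eps ∧
            (∑ k ∈ Finset.range K, (J k : ℝ)) ≤
              c * (1 + Real.log (sigma⁻¹ * lam * (Lf - muf)) +
                  Real.log (R0 ^ 2 / (lam * eps) + 1) +
                  Real.log (1 / (lam * muf) + 1)) ^ c *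
                (1 + min (Real.sqrt (Lf / muf)) (R0 * Real.sqrt (Lf / eps)))) := by
  refine ⟨42, by norm_num, ?_⟩
  intro n domh f h f' muf Lf lam sigma eps hLf hmu hmuL hs hs1 hlam heps hsc hf _ hc _ _ _
    w v vt bo Bo tauo xin yin xtin ytin ain Ain tauin Thin J H hfirst xstar R0 hxs hmin hR0 _
  have hL : 0 < Lf - muf := by linarith
  have hout := outer_main hmu hL hs hs1 hlam hsc hf hc H hxs
  obtain ⟨hB0, -, -, -, -, hB, -, -, hacg, hth, -⟩ := H
  have hmu' : 1 / lam ≤ muf + 1 / lam := by linarith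
  have hmu0 : 0 ≤ muf + 1 / lam := by positivity
  have hcount : 1 ≤ lam * (Lf - muf) → ∀ k, (J k : ℝ) ≤
      14 * Real.sqrt (lam * (Lf - muf)) * (1 + Real.log (sigma⁻¹ * lam * (Lf - muf))) := by
    intro hlL k
    apply inner_count (hacg k) hL hlam hs hs1 hmu' hlL (J k)
    intro j hj1 hj2
    by_contra hcon
    push Not at hcon
    exact hfirst k j hj1 hj2 (acg_stop (hacg k) (hth k) hL hmu0 hc
      (fun x u => g_low hsc hf.1 hlam (vt k) x u) (fun x u => g_up hf hlam (vt k) x u) j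
      hlam hs hs1 hcon)
  exact final_num hmu hL hs hs1 hlam heps hB (fun k => (hout k).1) (fun k => (hout k).2.1)
    (fun k => (hout k).2.2.1) (fun k => (hout k).2.2.2.1) hB0 (by rw [hR0]; positivity)
    (fun k => f (w k) + h (w k) - (f xstar + h xstar)) (by
      intro k
      obtain ⟨q1, q2, -, -, -, q6⟩ := hout k
      have q7 : 0 ≤ tauo k / 2 * ‖xstar - v k‖ ^ 2 := by rw [q2]; positivity
      rw [hR0, norm_sub_rev (w 0)]
      linarith) hcount
end
end

section
/- Consider the linearly constrained problem min{φ(x) = f(x) + h(x) : Ax = b} under the standing assumptions, and let the Inexact Augmented Lagrangian Method (Algorithm 3) be run with ε_0 = ε, σ = 1/2, and ρ = ε⁻¹. Then Algorithm 3 finds an ε-primal-dual solution within a number of total ACG iterations bounded by (1 + R_Λ²)(1 + D(√(L_f)/√ε + ‖A‖/ε)) up to a universal constant factor and factors polylogarithmic in the problem parameters (D, L_f, ‖A‖, 1/ε, 1/(1−α)), where R_Λ = min{‖λ − λ_0‖ : λ ∈ Λ_*} and Λ_* is the set of maximizers of the Lagrangian dual d. -/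
noncomputable section

open Set
open scoped RealInnerProductSpace BigOperators

variable {n m : ℕ}

/-- The tolerance `ε_k = (ε₀ αᵏ + σρε²)/2` of the I-ALM. -/
def epsALM (eps0 alpha sigma rho eps : ℝ) (k : ℕ) : ℝ :=
  (eps0 * alpha ^ k + sigma * rho * eps ^ 2) / 2

/-- The gradient `u ↦ ∇f(u) + Aᵀλ + ρAᵀ(Au - b)` of the smooth part of the augmented
Lagrangian `L_ρ(·,λ)`. -/
def augGrad (f' : Euc n → Euc n) (A : Euc n →L[ℝ] Euc m) (bvec : Euc m)
    (rho : ℝ) (lam : Euc m) (u : Euc n) : Euc n :=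
  f' u + (ContinuousLinearMap.adjoint A) lam +
    rho • (ContinuousLinearMap.adjoint A) (A u - bvec)

/-- A full run of the Inexact Augmented Lagrangian Method (Algorithm 3) on
`min {f + h : Ax = b}`.  At outer iteration `k`, ACG (Algorithm 1) is run on
`ψ = L_ρ(·,λ_k) + (ε_k/(8D²))‖· - x_k‖²` (with `L = M_ρ = L_f + ρ‖A‖²`,
`μ = ε_k/(4D²)`) from `x_k`; `P k j` is the prox point and `Gm k j` the gradient mapping
of `L_ρ(·,λ_k)` (with stepsize `(2L+μ)⁻¹`) at the inner iterate `x̃_j`; the inner call is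
stopped at the first index `J k` with `‖Gm k (J k)‖ ≤ ε_k/(2D)`; then
`x_{k+1} = x̃_{J k} - (2L+μ)⁻¹ Gm k (J k)` and `λ_{k+1} = λ_k + ρ(Ax_{k+1} - b)`. -/
def ALMSpec (domh : Set (Euc n)) (f h : Euc n → ℝ) (f' : Euc n → Euc n)
    (A : Euc n →L[ℝ] Euc m) (bvec : Euc m)
    (Lf D rho eps eps0 alpha sigma : ℝ)
    (xseq : ℕ → Euc n) (lamseq : ℕ → Euc m)
    (xin yin xtin ytin : ℕ → ℕ → Euc n) (ain Ain tauin : ℕ → ℕ → ℝ)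
    (P Gm : ℕ → ℕ → Euc n) (J : ℕ → ℕ) : Prop :=
  lamseq 0 = 0 ∧
  (∀ k, ACGSpec domh
      (fun u => f u + ⟪lamseq k, A u - bvec⟫ + rho / 2 * ‖A u - bvec‖ ^ 2 +
        epsALM eps0 alpha sigma rho eps k / (8 * D ^ 2) * ‖u - xseq k‖ ^ 2)
      h
      (fun u => augGrad f' A bvec rho (lamseq k) u +
        (epsALM eps0 alpha sigma rho eps k / (4 * D ^ 2)) • (u - xseq k))
      (Lf + rho * ‖A‖ ^ 2)
      (epsALM eps0 alpha sigma rho eps k / (4 * D ^ 2))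
      (xseq k) (xin k) (yin k) (xtin k) (ytin k) (ain k) (Ain k) (tauin k)) ∧
  (∀ k j, IsProxPt domh h
      (2 * (Lf + rho * ‖A‖ ^ 2) + epsALM eps0 alpha sigma rho eps k / (4 * D ^ 2))⁻¹
      (xtin k j -
        (2 * (Lf + rho * ‖A‖ ^ 2) + epsALM eps0 alpha sigma rho eps k / (4 * D ^ 2))⁻¹ •
          augGrad f' A bvec rho (lamseq k) (xtin k j))
      (P k j)) ∧
  (∀ k j, Gm k j =
      (2 * (Lf + rho * ‖A‖ ^ 2) + epsALM eps0 alpha sigma rho eps k / (4 * D ^ 2)) •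
        (xtin k j - P k j)) ∧
  (∀ k, ‖Gm k (J k)‖ ≤ epsALM eps0 alpha sigma rho eps k / (2 * D)) ∧
  (∀ k j, j < J k → ¬(‖Gm k j‖ ≤ epsALM eps0 alpha sigma rho eps k / (2 * D))) ∧
  (∀ k, xseq (k + 1) = xtin k (J k) -
      (2 * (Lf + rho * ‖A‖ ^ 2) + epsALM eps0 alpha sigma rho eps k / (4 * D ^ 2))⁻¹ •
        Gm k (J k)) ∧
  (∀ k, lamseq (k + 1) = lamseq k + rho • (A (xseq (k + 1)) - bvec))
lemma hasDerivAt_line (f : Euc n → ℝ) (f' : Euc n → Euc n)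
    (hf : ∀ x, HasGradientAt f (f' x) x) (x d : Euc n) (t : ℝ) :
    HasDerivAt (fun t : ℝ => f (x + t • d)) ⟪f' (x + t • d), d⟫ t := by
  have h1 : HasDerivAt (fun t : ℝ => x + t • d) d t := by
    simpa using ((hasDerivAt_id t).smul_const d).const_add x
  have h2 := (hf (x + t • d)).hasFDerivAt.comp_hasDerivAt t h1
  simpa [Function.comp_def] using h2

lemma descent (f : Euc n → ℝ) (f' : Euc n → Euc n) (L : ℝ) (hf : HasLipGrad f f' L)
    (x y : Euc n) : f y ≤ f x + ⟪f' x, y - x⟫ + L / 2 * ‖y - x‖ ^ 2 := by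
  obtain ⟨h1, h2⟩ := hf
  set d := y - x with hd
  have hB : ∀ t : ℝ, HasDerivAt (fun t : ℝ => f x + t * ⟪f' x, d⟫ + L / 2 * t ^ 2 * ‖d‖ ^ 2)
      (⟪f' x, d⟫ + L * t * ‖d‖ ^ 2) t := by
    intro t
    have e1 : HasDerivAt (fun t : ℝ => f x + t * ⟪f' x, d⟫) (1 * ⟪f' x, d⟫) t :=
      ((hasDerivAt_id t).mul_const _).const_add _
    have e2 := (((hasDerivAt_pow 2 t).const_mul (L / 2)).mul_const (‖d‖ ^ 2))
    exact (e1.add e2).congr_deriv (by push_cast; ring)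
  have key := image_le_of_deriv_right_le_deriv_boundary (f := fun t : ℝ => f (x + t • d))
    (f' := fun t => ⟪f' (x + t • d), d⟫) (a := 0) (b := 1)
    (fun t _ => (hasDerivAt_line f f' h1 x d t).continuousAt.continuousWithinAt)
    (fun t _ => (hasDerivAt_line f f' h1 x d t).hasDerivWithinAt)
    (B := fun t : ℝ => f x + t * ⟪f' x, d⟫ + L / 2 * t ^ 2 * ‖d‖ ^ 2)
    (B' := fun t => ⟪f' x, d⟫ + L * t * ‖d‖ ^ 2) (by simp)
    (fun t _ => (hB t).continuousAt.continuousWithinAt)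
    (fun t _ => (hB t).hasDerivWithinAt)
    (by
      intro t ht
      have e : ⟪f' (x + t • d) - f' x, d⟫ ≤ ‖f' (x + t • d) - f' x‖ * ‖d‖ :=
        real_inner_le_norm _ _
      have e2 := h2 (x + t • d) x
      rw [add_sub_cancel_left, norm_smul, Real.norm_of_nonneg ht.1] at e2
      rw [inner_sub_left] at e
      nlinarith [norm_nonneg d])
    (show (1:ℝ) ∈ Icc (0:ℝ) 1 by simp)
  have hy : x + d = y := by simp [hd]
  simpa [hy] using key

lemma convex_lower (f : Euc n → ℝ) (f' : Euc n → Euc n) (hc : ConvexOn ℝ univ f)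
    (hf : ∀ x, HasGradientAt f (f' x) x) (x y : Euc n) :
    f x + ⟪f' x, y - x⟫ ≤ f y := by
  have hcv : ConvexOn ℝ univ (fun t : ℝ => f (x + t • (y - x))) := by
    refine ⟨convex_univ, ?_⟩
    intro s _ t _ a b ha hb hab
    have := hc.2 (mem_univ (x + s • (y - x))) (mem_univ (x + t • (y - x))) ha hb hab
    convert this using 2
    have : x = (a + b) • x := by rw [hab, one_smul]
    nth_rewrite 1 [this]
    module
  have := hcv.le_slope_of_hasDerivAt (mem_univ 0) (mem_univ 1) one_pos
    (hasDerivAt_line f f' hf x (y - x) 0)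
  simp [slope] at this
  linarith

/-- first order sandwich -/
def Sand (q : Euc n → ℝ) (q' : Euc n → Euc n) (mu L : ℝ) : Prop :=
  ∀ x y, q x + ⟪q' x, y - x⟫ + mu / 2 * ‖y - x‖ ^ 2 ≤ q y ∧
    q y ≤ q x + ⟪q' x, y - x⟫ + L / 2 * ‖y - x‖ ^ 2

lemma sand_aug (f : Euc n → ℝ) (f' : Euc n → Euc n) (Lf : ℝ) (hc : ConvexOn ℝ univ f)
    (hf : HasLipGrad f f' Lf) (A : Euc n →L[ℝ] Euc m) (b lam : Euc m) (rho : ℝ)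
    (hr : 0 ≤ rho) :
    Sand (fun u => f u + ⟪lam, A u - b⟫ + rho / 2 * ‖A u - b‖ ^ 2)
      (augGrad f' A b rho lam) 0 (Lf + rho * ‖A‖ ^ 2) := by
  intro x y
  have e1 := descent f f' Lf hf x y
  have e2 := convex_lower f f' hc hf.1 x y
  have e3 : A y - b = (A x - b) + A (y - x) := by rw [map_sub]; abel
  have e4 : ‖A (y - x)‖ ^ 2 ≤ ‖A‖ ^ 2 * ‖y - x‖ ^ 2 := by
    rw [← mul_pow]; exact pow_le_pow_left₀ (norm_nonneg _) (A.le_opNorm _) 2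
  have e5 : ⟪augGrad f' A b rho lam x, y - x⟫ =
      ⟪f' x, y - x⟫ + ⟪lam, A (y - x)⟫ + rho * ⟪A x - b, A (y - x)⟫ := by
    unfold augGrad
    rw [inner_add_left, inner_add_left, real_inner_smul_left,
      ContinuousLinearMap.adjoint_inner_left, ContinuousLinearMap.adjoint_inner_left]
  have e6 : ‖A y - b‖ ^ 2 = ‖A x - b‖ ^ 2 + 2 * ⟪A x - b, A (y - x)⟫ + ‖A (y - x)‖ ^ 2 := by
    rw [e3]; exact norm_add_sq_real _ _
  have e7 : ⟪lam, A y - b⟫ = ⟪lam, A x - b⟫ + ⟪lam, A (y - x)⟫ := by rw [e3, inner_add_right]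
  have e8 := mul_le_mul_of_nonneg_left e4 hr
  have e9 : 0 ≤ rho * ‖A (y - x)‖ ^ 2 := by positivity
  simp only [e5, e6, e7]
  constructor <;> nlinarith

lemma sand_quad (q : Euc n → ℝ) (q' : Euc n → Euc n) (mu L k : ℝ) (h : Sand q q' mu L)
    (c : Euc n) : Sand (fun u => q u + k / 2 * ‖u - c‖ ^ 2) (fun u => q' u + k • (u - c))
      (mu + k) (L + k) := by
  intro x y
  obtain ⟨h1, h2⟩ := h x y
  have e : ‖y - c‖ ^ 2 = ‖x - c‖ ^ 2 + 2 * ⟪x - c, y - x⟫ + ‖y - x‖ ^ 2 := by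
    rw [← norm_add_sq_real]; congr 2; abel
  simp only [inner_add_left, real_inner_smul_left, e]
  constructor <;> nlinarith

lemma coco (q : Euc n → ℝ) (q' : Euc n → Euc n) (L : ℝ) (hL : 0 < L) (h : Sand q q' 0 L)
    (x y : Euc n) : ‖q' y - q' x‖ ^ 2 ≤ L * ⟪q' y - q' x, y - x⟫ := by
  have main : ∀ x y : Euc n, q x + ⟪q' x, y - x⟫ + 1 / (2 * L) * ‖q' y - q' x‖ ^ 2 ≤ q y := by
    intro x y
    set w := q' y - q' x with hw
    have h1 := (h y (y - (1 / L) • w)).2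
    have h2 := (h x (y - (1 / L) • w)).1
    have e1 : y - (1 / L) • w - y = -((1 / L) • w) := by abel
    have e2 : y - (1 / L) • w - x = (y - x) - (1 / L) • w := by abel
    rw [e1, inner_neg_right, real_inner_smul_right, norm_neg, norm_smul,
      Real.norm_of_nonneg (by positivity)] at h1
    rw [e2, inner_sub_right, real_inner_smul_right] at h2
    have e3 : ⟪q' y, w⟫ - ⟪q' x, w⟫ = ‖w‖ ^ 2 := by
      rw [← inner_sub_left, ← hw, real_inner_self_eq_norm_sq]
    have e4 : L / 2 * (1 / L * ‖w‖) ^ 2 = 1 / (2 * L) * ‖w‖ ^ 2 := by field_simp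
    have e5 : 1 / L * ⟪q' y, w⟫ = 1 / L * ⟪q' x, w⟫ + 2 * (1 / (2 * L) * ‖w‖ ^ 2) := by
      rw [← e3]; field_simp; ring
    rw [e4] at h1
    linarith
  have a1 := main x y
  have a2 := main y x
  have e1 : ‖q' x - q' y‖ = ‖q' y - q' x‖ := norm_sub_rev _ _
  have e2 : ⟪q' y, x - y⟫ = - ⟪q' y, y - x⟫ := by rw [← inner_neg_right]; congr 1; abel
  rw [inner_sub_left]
  rw [e1, e2] at a2
  have : 1 / L * ‖q' y - q' x‖ ^ 2 ≤ ⟪q' y, y - x⟫ - ⟪q' x, y - x⟫ := by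
    have : 1 / L * ‖q' y - q' x‖ ^ 2 = 2 * (1 / (2 * L) * ‖q' y - q' x‖ ^ 2) := by field_simp
    linarith
  rw [one_div, inv_mul_le_iff₀ hL] at this
  exact this

lemma lin_nonneg (α β : ℝ) (h : ∀ t : ℝ, 0 < t → t ≤ 1 → 0 ≤ t * α + t ^ 2 * β) : 0 ≤ α := by
  by_contra hα
  push Not at hα
  have hb : 0 < |β| + 1 := by positivity
  have hd : 0 < -α + (|β| + 1) := by linarith
  have ht : 0 < -α / (-α + (|β| + 1)) := div_pos (by linarith) hd
  set t := -α / (-α + (|β| + 1)) with htd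
  have ht1 : t ≤ 1 := by rw [htd, div_le_one hd]; linarith
  have e : t * (-α + (|β| + 1)) = -α := by rw [htd]; field_simp
  have h1 := h t ht ht1
  have h2 : 0 ≤ α + t * β := by
    by_contra h3; push Not at h3
    nlinarith
  nlinarith [le_abs_self β]

lemma prox_ineq (s : Set (Euc n)) (h : Euc n → ℝ) (hc : ConvexOn ℝ s h) (M : ℝ)
    (c x p : Euc n) (hp : p ∈ s)
    (hmin : ∀ u ∈ s, ⟪c, p - x⟫ + h p + M / 2 * ‖p - x‖ ^ 2 ≤
      ⟪c, u - x⟫ + h u + M / 2 * ‖u - x‖ ^ 2) (u : Euc n) (hu : u ∈ s) :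
    h p + ⟪M • (x - p) - c, u - p⟫ ≤ h u := by
  suffices 0 ≤ h u - h p - ⟪M • (x - p) - c, u - p⟫ by linarith
  apply lin_nonneg _ (M / 2 * ‖u - p‖ ^ 2)
  intro t ht ht1
  have hcv := hc.2 hp hu (show 0 ≤ 1 - t by linarith) ht.le (by ring)
  have hmem := hc.1 hp hu (show 0 ≤ 1 - t by linarith) ht.le (by ring)
  have e : (1 - t) • p + t • u = p + t • (u - p) := by module
  rw [e] at hcv hmem
  have h1 := hmin _ hmem
  have e1 : p + t • (u - p) - x = (p - x) + t • (u - p) := by abel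
  have e2 : ‖(p - x) + t • (u - p)‖ ^ 2 =
      ‖p - x‖ ^ 2 + 2 * (t * ⟪p - x, u - p⟫) + t ^ 2 * ‖u - p‖ ^ 2 := by
    rw [norm_add_sq_real, real_inner_smul_right, norm_smul, mul_pow, Real.norm_eq_abs, sq_abs]
  have e3 : ⟪x - p, u - p⟫ = - ⟪p - x, u - p⟫ := by rw [← inner_neg_left]; congr 1; abel
  rw [e1, e2, inner_add_right, real_inner_smul_right] at h1
  rw [inner_sub_left, real_inner_smul_left, e3]
  simp only [smul_eq_mul] at hcv
  nlinarith

lemma acg_step (L mu A a τ : ℝ) (hL : 0 ≤ L) (hmu : 0 ≤ mu) (hA : 0 ≤ A) (ha : 0 < a)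
    (hτ : 0 < τ) (hq : 2 * L * a ^ 2 = τ * (A + a)) (x y x' p xt u : Euc n)
    (ψp ψy ψu : ℝ)
    (hxt : (A + a) • xt = A • y + a • x)
    (hx' : (τ + mu * a) • x' = τ • x - (2 * L * a) • (xt - p) + (mu * a) • p)
    (hKu : ψp - L / 2 * ‖xt - p‖ ^ 2 + 2 * L * ⟪xt - p, u - p⟫ + mu / 2 * ‖u - p‖ ^ 2 ≤ ψu)
    (hKy : ψp - L / 2 * ‖xt - p‖ ^ 2 + 2 * L * ⟪xt - p, y - p⟫ + mu / 2 * ‖y - p‖ ^ 2 ≤ ψy) :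
    (A + a) * (ψp - ψu) + (τ + mu * a) / 2 * ‖x' - u‖ ^ 2 + (A + a) * L / 2 * ‖xt - p‖ ^ 2 ≤
      A * (ψy - ψu) + τ / 2 * ‖x - u‖ ^ 2 := by
  have _ := hL
  obtain ⟨X, rfl⟩ : ∃ X, x = X + p := ⟨x - p, by simp⟩
  obtain ⟨Y, rfl⟩ : ∃ X, y = X + p := ⟨y - p, by simp⟩
  obtain ⟨X', rfl⟩ : ∃ X, x' = X + p := ⟨x' - p, by simp⟩
  obtain ⟨U, rfl⟩ : ∃ X, u = X + p := ⟨u - p, by simp⟩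
  obtain ⟨s, rfl⟩ : ∃ X, xt = X + p := ⟨xt - p, by simp⟩
  simp only [add_sub_cancel_right, add_sub_add_right_eq_sub] at *
  have h1 : (A + a) • s = A • Y + a • X := by
    have : (A + a) • s = (A + a) • (s + p) - (A + a) • p := by module
    rw [this, hxt]; module
  have h2 : (τ + mu * a) • X' = τ • X - (2 * L * a) • s := by
    have : (τ + mu * a) • X' = (τ + mu * a) • (X' + p) - (τ + mu * a) • p := by module
    rw [this, hx']; module
  have i1 : (A + a) * ‖s‖ ^ 2 = A * ⟪s, Y⟫ + a * ⟪s, X⟫ := by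
    have := congrArg (fun z => ⟪s, z⟫) h1
    simpa [inner_add_right, real_inner_smul_right, real_inner_self_eq_norm_sq] using this
  have i2 : (τ + mu * a) * ⟪X', U⟫ = τ * ⟪X, U⟫ - 2 * L * a * ⟪s, U⟫ := by
    have := congrArg (fun z => ⟪z, U⟫) h2
    simpa only [inner_sub_left, real_inner_smul_left] using this
  have i3 : (τ + mu * a) * ‖X'‖ ^ 2 = τ * ⟪X, X'⟫ - 2 * L * a * ⟪s, X'⟫ := by
    have := congrArg (fun z => ⟪z, X'⟫) h2
    simpa only [inner_sub_left, real_inner_smul_left, real_inner_self_eq_norm_sq] using this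
  have i4 : 0 ≤ τ ^ 2 * (‖X‖ ^ 2 - 2 * ⟪X, X'⟫ + ‖X'‖ ^ 2) +
      2 * (τ * (2 * L * a) * (⟪s, X'⟫ - ⟪s, X⟫)) + (2 * L * a) ^ 2 * ‖s‖ ^ 2 := by
    have := sq_nonneg ‖τ • (X' - X) + (2 * L * a) • s‖
    rw [norm_add_sq_real, norm_smul, norm_smul, mul_pow, mul_pow, real_inner_smul_left,
      real_inner_smul_right, Real.norm_eq_abs, Real.norm_eq_abs, sq_abs, sq_abs,
      norm_sub_sq_real, inner_sub_left, real_inner_comm s X', real_inner_comm s X,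
      real_inner_comm X X'] at this
    linarith
  have i5 : 0 ≤ τ / 2 * (‖X‖ ^ 2 - 2 * ⟪X, X'⟫ + ‖X'‖ ^ 2) +
      2 * L * a * (⟪s, X'⟫ - ⟪s, X⟫) + (A + a) * L * ‖s‖ ^ 2 := by
    have e : (2 * L * a) ^ 2 = 2 * L * (τ * (A + a)) := by rw [← hq]; ring
    rw [e] at i4
    have : 0 ≤ (2 * τ) * (τ / 2 * (‖X‖ ^ 2 - 2 * ⟪X, X'⟫ + ‖X'‖ ^ 2) +
      2 * L * a * (⟪s, X'⟫ - ⟪s, X⟫) + (A + a) * L * ‖s‖ ^ 2) := by nlinarith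
    exact nonneg_of_mul_nonneg_right this (by positivity)
  have j1 := mul_le_mul_of_nonneg_left hKu ha.le
  have j2 := mul_le_mul_of_nonneg_left hKy hA
  have j3 : 0 ≤ A * (mu / 2 * ‖Y‖ ^ 2) := by positivity
  have j4 : 0 ≤ a * (mu / 2 * ‖X'‖ ^ 2) := by positivity
  have j5 : 2 * L * ((A + a) * ‖s‖ ^ 2) = 2 * L * (A * ⟪s, Y⟫ + a * ⟪s, X⟫) := by rw [i1]
  rw [norm_sub_sq_real, norm_sub_sq_real]
  linarith

lemma acg_res (domh : Set (Euc n)) (g h : Euc n → ℝ) (g' : Euc n → Euc n) (L mu D : ℝ)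
    (x0 : Euc n) (x y xt yt : ℕ → Euc n) (a A tau : ℕ → ℝ)
    (hL : 0 < L) (hmu : 0 ≤ mu) (hg : Sand g g' mu (L + mu)) (hc : ConvexOn ℝ domh h)
    (hD : ∀ u ∈ domh, ∀ w ∈ domh, ‖u - w‖ ≤ D)
    (hS : ACGSpec domh g h g' L mu x0 x y xt yt a A tau) (j : ℕ) :
    A (j + 1) * L * ‖xt j - yt (j + 1)‖ ^ 2 ≤ D ^ 2 ∧
      (1 + Real.sqrt (mu / (2 * L))) ^ j / (2 * L) ≤ A (j + 1) := by
  obtain ⟨hA0, ht0, hx0, hy0, hx0m, ha, hA, ht, hxt, hytm, hytmin, hy, hx⟩ := hS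
  have htau : ∀ j, tau j = 1 + mu * A j := by
    intro j
    induction j with
    | zero => rw [ht0, hA0]; ring
    | succ j ih => rw [ht, hA, ih]; ring
  have hbasic : ∀ j, 0 ≤ A j ∧ 0 < a j := by
    intro j
    induction j with
    | zero =>
      refine ⟨hA0.ge, ?_⟩
      rw [ha, ht0]
      have := Real.sqrt_nonneg ((1:ℝ) ^ 2 + 8 * 1 * A 0 * L)
      positivity
    | succ j ih =>
      have h1 : 0 ≤ A (j + 1) := by rw [hA]; linarith [ih.1, ih.2]
      refine ⟨h1, ?_⟩
      rw [ha]
      have h2 : 0 < tau (j + 1) := by rw [htau]; positivity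
      have := Real.sqrt_nonneg (tau (j + 1) ^ 2 + 8 * tau (j + 1) * A (j + 1) * L)
      positivity
  have htpos : ∀ j, 0 < tau j := by
    intro j; have := (hbasic j).1; rw [htau]; positivity
  have hq : ∀ j, 2 * L * a j ^ 2 = tau j * (A j + a j) := by
    intro j
    have h1 := (hbasic j).1
    have h2 := htpos j
    have hs := Real.sq_sqrt (show 0 ≤ tau j ^ 2 + 8 * tau j * A j * L by positivity)
    have e : Real.sqrt (tau j ^ 2 + 8 * tau j * A j * L) = 4 * L * a j - tau j := by
      rw [ha j]; field_simp; ring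
    rw [e] at hs
    have : 8 * L * (2 * L * a j ^ 2) = 8 * L * (tau j * (A j + a j)) := by nlinarith
    exact mul_left_cancel₀ (by positivity) this
  have hym : ∀ j, y j ∈ domh := by
    intro j
    induction j with
    | zero => rw [hy0]; exact hx0m
    | succ j ih =>
      rcases (hy j).1 with e | e
      · rw [e]; exact ih
      · rw [e]; exact hytm j
  have hK : ∀ j, ∀ u ∈ domh, g (yt (j + 1)) + h (yt (j + 1)) - L / 2 * ‖xt j - yt (j + 1)‖ ^ 2
      + 2 * L * ⟪xt j - yt (j + 1), u - yt (j + 1)⟫ + mu / 2 * ‖u - yt (j + 1)‖ ^ 2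
      ≤ g u + h u := by
    intro j u hu
    have p1 := prox_ineq domh h hc (2 * L + mu) (g' (xt j)) (xt j) (yt (j + 1)) (hytm j)
      (fun u hu => by have := hytmin j u hu; linarith) u hu
    have p2 := (hg (xt j) u).1
    have p3 := (hg (xt j) (yt (j + 1))).2
    set p := yt (j + 1)
    set z := xt j
    have e1 : ‖u - z‖ ^ 2 = ‖u - p‖ ^ 2 - 2 * ⟪z - p, u - p⟫ + ‖z - p‖ ^ 2 := by
      have : u - z = (u - p) - (z - p) := by abel
      rw [this, norm_sub_sq_real, real_inner_comm]
    have e2 : ‖p - z‖ = ‖z - p‖ := norm_sub_rev _ _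
    have e3 : ⟪g' z, u - z⟫ = ⟪g' z, u - p⟫ + ⟪g' z, p - z⟫ := by
      rw [← inner_add_right]; congr 1; abel
    rw [inner_sub_left, real_inner_smul_left] at p1
    rw [e1, e3] at p2
    rw [e2] at p3
    nlinarith
  have hstep : ∀ u ∈ domh, ∀ j, A (j + 1) * (g (y (j + 1)) + h (y (j + 1)) - (g u + h u))
      + tau (j + 1) / 2 * ‖x (j + 1) - u‖ ^ 2 + A (j + 1) * L / 2 * ‖xt j - yt (j + 1)‖ ^ 2
      ≤ A j * (g (y j) + h (y j) - (g u + h u)) + tau j / 2 * ‖x j - u‖ ^ 2 := by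
    intro u hu j
    have hAp : 0 < A j + a j := by linarith [(hbasic j).1, (hbasic j).2]
    have hxt' : (A j + a j) • xt j = A j • y j + a j • x j := by
      rw [hxt, hA, smul_add, smul_smul, smul_smul, mul_div_cancel₀ _ hAp.ne',
        mul_div_cancel₀ _ hAp.ne']
    have hxx : (tau j + mu * a j) • x (j + 1) = tau j • x j - (2 * L * a j) • (xt j - yt (j + 1))
        + (mu * a j) • yt (j + 1) := by
      have e0 : A (j + 1) * mu + 1 = tau j + mu * a j := by rw [htau, hA]; ring
      have e1 : tau j + mu * a j ≠ 0 := by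
        have := htpos j; have := (hbasic j).2; positivity
      rw [hx, e0, smul_smul, mul_inv_cancel₀ e1, one_smul, hxt, hA]
      have e2 : tau j = 2 * L * a j * (a j / (A j + a j)) := by
        have := hq j
        field_simp
        linarith
      rw [e2]
      have e3 : 2 * A j * a j * L / (A j + a j) = 2 * L * a j * (A j / (A j + a j)) := by ring
      rw [e3]
      module
    have := acg_step L mu (A j) (a j) (tau j) hL.le hmu (hbasic j).1 (hbasic j).2 (htpos j) (hq j)
      (x j) (y j) (x (j + 1)) (yt (j + 1)) (xt j) u (g (yt (j + 1)) + h (yt (j + 1)))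
      (g (y j) + h (y j)) (g u + h u) hxt' hxx (hK j u hu) (hK j _ (hym j))
    rw [hA, ht]
    have h3 := mul_le_mul_of_nonneg_left (hy j).2.2 hAp.le
    nlinarith
  have hE : ∀ u ∈ domh, ∀ j, A j * (g (y j) + h (y j) - (g u + h u)) + tau j / 2 * ‖x j - u‖ ^ 2
      ≤ D ^ 2 / 2 := by
    intro u hu j
    induction j with
    | zero =>
      rw [hA0, ht0, hx0]
      have := hD x0 hx0m u hu
      nlinarith [norm_nonneg (x0 - u)]
    | succ j ih =>
      have h1 := hstep u hu j
      have : 0 ≤ A (j + 1) * L / 2 * ‖xt j - yt (j + 1)‖ ^ 2 := by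
        have := (hbasic (j + 1)).1; positivity
      linarith
  constructor
  · have h1 := hstep (y (j + 1)) (hym _) j
    have h2 := hE (y (j + 1)) (hym _) j
    have h3 : 0 ≤ tau (j + 1) / 2 * ‖x (j + 1) - y (j + 1)‖ ^ 2 := by
      have := htpos (j + 1); positivity
    rw [sub_self, mul_zero] at h1
    linarith
  · induction j with
    | zero =>
      have h1 := hq 0
      rw [ht0, hA0] at h1
      have h2 := (hbasic 0).2
      have : 2 * L * a 0 = 1 := by
        apply mul_left_cancel₀ h2.ne'; linarith
      rw [hA, hA0, pow_zero, div_le_iff₀ (by positivity)]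
      linarith
    | succ j ih =>
      have h1 := hq (j + 1)
      have h2 := (hbasic (j + 1)).1
      have h3 := (hbasic (j + 1)).2
      set q := Real.sqrt (mu / (2 * L)) with hqd
      have hq0 : 0 ≤ q := Real.sqrt_nonneg _
      have hq2 : q ^ 2 * (2 * L) = mu := by
        rw [hqd, Real.sq_sqrt (by positivity)]; field_simp
      have h4 : q * A (j + 1) ≤ a (j + 1) := by
        apply (sq_le_sq₀ (by positivity) h3.le).1
        have : 2 * L * (q * A (j + 1)) ^ 2 ≤ 2 * L * a (j + 1) ^ 2 := by
          rw [h1, htau]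
          have : 2 * L * (q * A (j + 1)) ^ 2 = mu * A (j + 1) * A (j + 1) := by
            rw [← hq2]; ring
          rw [this]
          have : 0 ≤ mu * A (j + 1) * a (j + 1) := by positivity
          nlinarith
        exact le_of_mul_le_mul_left this (by positivity)
      rw [hA (j + 1), pow_succ, mul_comm, mul_div_assoc]
      calc (1 + q) * ((1 + q) ^ j / (2 * L)) ≤ (1 + q) * A (j + 1) :=
            mul_le_mul_of_nonneg_left ih (by positivity)
        _ ≤ _ := by linarith

lemma prox_conv (s : Set (Euc n)) (h : Euc n → ℝ) (M : ℝ) (hM : 0 < M) (c x p : Euc n)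
    (hp : IsProxPt s h M⁻¹ (x - M⁻¹ • c) p) (u : Euc n) (hu : u ∈ s) :
    ⟪c, p - x⟫ + h p + M / 2 * ‖p - x‖ ^ 2 ≤ ⟪c, u - x⟫ + h u + M / 2 * ‖u - x‖ ^ 2 := by
  have h1 := hp.2 hu
  have e : ∀ w : Euc n, ‖w - (x - M⁻¹ • c)‖ ^ 2 =
      ‖w - x‖ ^ 2 + 2 * (M⁻¹ * ⟪c, w - x⟫) + ‖M⁻¹ • c‖ ^ 2 := by
    intro w
    have : w - (x - M⁻¹ • c) = (w - x) + M⁻¹ • c := by abel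
    rw [this, norm_add_sq_real, real_inner_smul_right, real_inner_comm]
  rw [e, e] at h1
  have e2 : ∀ w : Euc n, M * (M⁻¹ * h w + (‖w - x‖ ^ 2 + 2 * (M⁻¹ * ⟪c, w - x⟫)
      + ‖M⁻¹ • c‖ ^ 2) / 2) = ⟪c, w - x⟫ + h w + M / 2 * ‖w - x‖ ^ 2 + M / 2 * ‖M⁻¹ • c‖ ^ 2 := by
    intro w; field_simp; ring
  have h2 := mul_le_mul_of_nonneg_left h1 hM.le
  rw [e2, e2] at h2
  linarith

lemma prox_nonexp (s : Set (Euc n)) (h : Euc n → ℝ) (hc : ConvexOn ℝ s h) (M : ℝ)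
    (c c2 x p p2 : Euc n) (hp : p ∈ s) (hp2 : p2 ∈ s)
    (h1 : ∀ u ∈ s, ⟪c, p - x⟫ + h p + M / 2 * ‖p - x‖ ^ 2 ≤
      ⟪c, u - x⟫ + h u + M / 2 * ‖u - x‖ ^ 2)
    (h2 : ∀ u ∈ s, ⟪c2, p2 - x⟫ + h p2 + M / 2 * ‖p2 - x‖ ^ 2 ≤
      ⟪c2, u - x⟫ + h u + M / 2 * ‖u - x‖ ^ 2) :
    M * ‖p2 - p‖ ≤ ‖c2 - c‖ := by
  have a1 := prox_ineq s h hc M c x p hp h1 p2 hp2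
  have a2 := prox_ineq s h hc M c2 x p2 hp2 h2 p hp
  have e1 : ⟪M • (x - p2) - c2, p - p2⟫ = - ⟪M • (x - p2) - c2, p2 - p⟫ := by
    rw [← inner_neg_right]; congr 1; abel
  have e2 : ⟪M • (x - p) - c, p2 - p⟫ - ⟪M • (x - p2) - c2, p2 - p⟫
      = M * ‖p2 - p‖ ^ 2 + ⟪c2 - c, p2 - p⟫ := by
    rw [← inner_sub_left, ← real_inner_self_eq_norm_sq, ← real_inner_smul_left, ← inner_add_left]
    congr 1; module
  have e3 : - ⟪c2 - c, p2 - p⟫ ≤ ‖c2 - c‖ * ‖p2 - p‖ := by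
    rw [← inner_neg_left, ← norm_neg (c2 - c)]; exact real_inner_le_norm _ _
  rcases (norm_nonneg (p2 - p)).eq_or_lt with e | e
  · rw [← e, mul_zero]; exact norm_nonneg _
  · apply le_of_mul_le_mul_right _ e
    nlinarith

lemma v_bound (q : Euc n → ℝ) (q' : Euc n → Euc n) (L M : ℝ) (hL : 0 < L) (hM : 2 * L ≤ M)
    (h : Sand q q' 0 L) (x p : Euc n) :
    ‖M • (x - p) + q' p - q' x‖ ≤ ‖M • (x - p)‖ := by
  apply (sq_le_sq₀ (norm_nonneg _) (norm_nonneg _)).1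
  have hc := coco q q' L hL h p x
  have e : M • (x - p) + q' p - q' x = M • (x - p) - (q' x - q' p) := by abel
  rw [e, norm_sub_sq_real, real_inner_smul_left, real_inner_comm]
  have h0 : 0 ≤ ⟪q' x - q' p, x - p⟫ := by
    by_contra hh; push Not at hh
    nlinarith [sq_nonneg ‖q' x - q' p‖]
  nlinarith

lemma le_exp_abs_log (x : ℝ) (hx : 0 ≤ x) : x ≤ Real.exp |Real.log x| := by
  rcases hx.eq_or_lt with h | h
  · rw [← h]; positivity
  · calc x = Real.exp (Real.log x) := (Real.exp_log h).symm
      _ ≤ _ := Real.exp_le_exp.2 (le_abs_self _)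

set_option maxHeartbeats 1000000 in
lemma numeric (D Lf N eps e S : ℝ) (hD : 1 ≤ D) (hLf : 0 < Lf) (hN : 0 ≤ N) (heps : 0 < eps)
    (he : eps / 4 ≤ e)
    (hS : 1 + |Real.log D| + |Real.log Lf| + |Real.log N| + |Real.log eps| ≤ S) (j : ℕ)
    (hj : (1 + Real.sqrt (e / (4 * D ^ 2) / (2 * (Lf + eps⁻¹ * N ^ 2)))) ^ j * e ^ 2 <
      128 * (2 * (Lf + eps⁻¹ * N ^ 2) + e / (4 * D ^ 2)) ^ 2 * D ^ 4) :
    (j : ℝ) ≤ 114 * S * (1 + D * (Real.sqrt Lf / Real.sqrt eps + N / eps)) := by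
  have he0 : 0 < e := by linarith
  have hD0 : 0 < D := by linarith
  have a1 := abs_nonneg (Real.log D)
  have a2 := abs_nonneg (Real.log Lf)
  have a3 := abs_nonneg (Real.log N)
  have a4 := abs_nonneg (Real.log eps)
  have hS1 : 1 ≤ S := by linarith
  set L := Lf + eps⁻¹ * N ^ 2 with hLdef
  have hL : 0 < L := by positivity
  set E := Real.exp S with hE
  have hE1 : (2.7 : ℝ) ≤ E := by
    have : Real.exp 1 ≤ E := Real.exp_le_exp.2 hS1
    linarith [Real.exp_one_gt_d9]
  have hDE : D ≤ E := (le_exp_abs_log D hD0.le).trans (Real.exp_le_exp.2 (by linarith))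
  have hie : eps⁻¹ ≤ Real.exp |Real.log eps| := by
    have := le_exp_abs_log eps⁻¹ (by positivity)
    rwa [Real.log_inv, abs_neg] at this
  have hLE : Lf * eps⁻¹ ≤ E := by
    calc Lf * eps⁻¹ ≤ Real.exp |Real.log Lf| * Real.exp |Real.log eps| :=
          mul_le_mul (le_exp_abs_log _ hLf.le) hie (by positivity) (by positivity)
      _ = Real.exp (|Real.log Lf| + |Real.log eps|) := (Real.exp_add _ _).symm
      _ ≤ E := Real.exp_le_exp.2 (by linarith)
  have hNE : N * eps⁻¹ ≤ E := by
    calc N * eps⁻¹ ≤ Real.exp |Real.log N| * Real.exp |Real.log eps| :=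
          mul_le_mul (le_exp_abs_log _ hN) hie (by positivity) (by positivity)
      _ = Real.exp (|Real.log N| + |Real.log eps|) := (Real.exp_add _ _).symm
      _ ≤ E := Real.exp_le_exp.2 (by linarith)
  have hLb : L * eps⁻¹ ≤ E + E ^ 2 := by
    have : L * eps⁻¹ = Lf * eps⁻¹ + (N * eps⁻¹) ^ 2 := by rw [hLdef]; ring
    rw [this]
    have := pow_le_pow_left₀ (by positivity) hNE 2
    linarith
  have hM : 2 * L + e / (4 * D ^ 2) ≤ 17 * e * E ^ 2 := by
    have h1 : e / (4 * D ^ 2) ≤ e := div_le_self he0.le (by nlinarith)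
    have h2 : L = (L * eps⁻¹) * eps := by field_simp
    have h3 : L ≤ (E + E ^ 2) * (4 * e) := by
      rw [h2]; exact mul_le_mul hLb (by linarith) heps.le (by positivity)
    have h4 : E ≤ E ^ 2 := by nlinarith
    have h5 : 1 ≤ E ^ 2 := by nlinarith
    nlinarith
  have hX : 128 * (2 * L + e / (4 * D ^ 2)) ^ 2 * D ^ 4 ≤ E ^ 19 * e ^ 2 := by
    calc 128 * (2 * L + e / (4 * D ^ 2)) ^ 2 * D ^ 4
        ≤ 128 * (17 * e * E ^ 2) ^ 2 * E ^ 4 := by gcongr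
      _ = 36992 * (E ^ 8 * e ^ 2) := by ring
      _ ≤ E ^ 11 * (E ^ 8 * e ^ 2) := by
          apply mul_le_mul_of_nonneg_right _ (by positivity)
          calc (36992 : ℝ) ≤ 2.7 ^ 11 := by norm_num
            _ ≤ E ^ 11 := by gcongr
      _ = _ := by ring
  set q := Real.sqrt (e / (4 * D ^ 2) / (2 * L)) with hq
  have hq0 : 0 < q := Real.sqrt_pos.2 (by positivity)
  have hpow : (1 + q) ^ j ≤ E ^ 19 :=
    le_of_mul_le_mul_right (hj.le.trans hX) (by positivity)
  have hlog : (j : ℝ) * Real.log (1 + q) ≤ 19 * S := by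
    have := Real.log_le_log (by positivity) hpow
    rw [Real.log_pow, Real.log_pow, hE, Real.log_exp] at this
    exact_mod_cast this
  have hlq : 1 - (1 + q)⁻¹ ≤ Real.log (1 + q) := Real.one_sub_inv_le_log_of_pos (by positivity)
  have hjq : (j : ℝ) * q ≤ 19 * S * (1 + q) := by
    have h1 : (j : ℝ) * (1 - (1 + q)⁻¹) ≤ 19 * S :=
      (mul_le_mul_of_nonneg_left hlq (Nat.cast_nonneg _)).trans hlog
    have h2 : (j : ℝ) * (1 - (1 + q)⁻¹) * (1 + q) = j * q := by field_simp; ring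
    rw [← h2]
    exact mul_le_mul_of_nonneg_right h1 (by positivity)
  set T := D * (Real.sqrt Lf / Real.sqrt eps + N / eps) with hT
  have hT0 : 0 ≤ T := by positivity
  have hTq : 1 ≤ 6 * T * q := by
    have h1 : D ^ 2 * (L * eps⁻¹) ≤ T ^ 2 := by
      rw [hT, mul_pow]
      apply mul_le_mul_of_nonneg_left _ (by positivity)
      have h2 : (Real.sqrt Lf / Real.sqrt eps) ^ 2 = Lf / eps := by
        rw [div_pow, Real.sq_sqrt hLf.le, Real.sq_sqrt heps.le]
      have h3 : 0 ≤ Real.sqrt Lf / Real.sqrt eps * (N / eps) := by positivity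
      have h4 : L * eps⁻¹ = Lf / eps + (N / eps) ^ 2 := by rw [hLdef]; field_simp
      rw [h4, add_sq, h2]; linarith
    have h2 : q ^ 2 = e / (4 * D ^ 2) / (2 * L) := Real.sq_sqrt (by positivity)
    have h3 : 1 ≤ (6 * T * q) ^ 2 := by
      calc (1:ℝ) ≤ 36 / 8 * (e / eps) := by
            have : 1 / 4 ≤ e / eps := by rw [le_div_iff₀ heps]; linarith
            linarith
        _ = 36 * (D ^ 2 * (L * eps⁻¹)) * (e / (4 * D ^ 2) / (2 * L)) := by field_simp; norm_num
        _ ≤ 36 * T ^ 2 * (e / (4 * D ^ 2) / (2 * L)) := by gcongr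
        _ = (6 * T * q) ^ 2 := by rw [← h2]; ring
    have h4 : 0 ≤ 6 * T * q := by positivity
    exact (one_le_sq_iff₀ h4).1 h3
  apply le_of_mul_le_mul_right _ hq0
  have : 19 * S * (1 + q) ≤ 19 * S * (6 * (1 + T) * q) := by
    apply mul_le_mul_of_nonneg_left _ (by positivity)
    linarith
  calc (j : ℝ) * q ≤ 19 * S * (6 * (1 + T) * q) := hjq.trans this
    _ = _ := by ring

lemma inner_fail (domh : Set (Euc n)) (g h : Euc n → ℝ) (q' : Euc n → Euc n)
    (L D e : ℝ) (x0 : Euc n) (x y xt yt : ℕ → Euc n) (a A tau : ℕ → ℝ)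
    (hL : 0 < L) (he : 0 < e) (hD1 : 1 ≤ D)
    (hg : Sand g (fun u => q' u + (e / (4 * D ^ 2)) • (u - x0))
      (e / (4 * D ^ 2)) (L + e / (4 * D ^ 2))) (hc : ConvexOn ℝ domh h)
    (hD : ∀ u ∈ domh, ∀ w ∈ domh, ‖u - w‖ ≤ D)
    (hS : ACGSpec domh g h (fun u => q' u + (e / (4 * D ^ 2)) • (u - x0)) L (e / (4 * D ^ 2))
      x0 x y xt yt a A tau) (j : ℕ) (P : Euc n)
    (hP : IsProxPt domh h (2 * L + e / (4 * D ^ 2))⁻¹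
      (xt j - (2 * L + e / (4 * D ^ 2))⁻¹ • q' (xt j)) P)
    (hG : ¬ ‖(2 * L + e / (4 * D ^ 2)) • (xt j - P)‖ ≤ e / (2 * D)) :
    (1 + Real.sqrt (e / (4 * D ^ 2) / (2 * L))) ^ j * e ^ 2 <
      128 * (2 * L + e / (4 * D ^ 2)) ^ 2 * D ^ 4 := by
  have hD0 : 0 < D := by linarith
  have hmuD : e / (4 * D ^ 2) * D = e / (4 * D) := by field_simp
  have hmu : 0 < e / (4 * D ^ 2) := by positivity
  obtain ⟨r1, r2⟩ := acg_res domh g h _ L _ D x0 x y xt yt a A tau hL hmu.le hg hc hD hS j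
  obtain ⟨-, -, -, -, hx0m, -, -, -, -, hytm, hytmin, -, -⟩ := hS
  set mu := e / (4 * D ^ 2) with hmud
  have hM : 0 < 2 * L + mu := by positivity
  set M := 2 * L + mu with hMd
  have ne := prox_nonexp domh h hc M (q' (xt j)) (q' (xt j) + mu • (xt j - x0)) (xt j) P
    (yt (j + 1)) hP.1 (hytm j) (fun u hu => prox_conv domh h M hM _ _ _ hP u hu)
    (fun u hu => by have := hytmin j u hu; simp only [] at this; linarith)
  rw [add_sub_cancel_left, norm_smul, Real.norm_of_nonneg hmu.le] at ne
  set s := ‖xt j - yt (j + 1)‖ with hs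
  have hs0 : 0 ≤ s := norm_nonneg _
  have t1 : ‖xt j - x0‖ ≤ s + D := by
    have := norm_add_le (xt j - yt (j + 1)) (yt (j + 1) - x0)
    rw [sub_add_sub_cancel] at this
    linarith [hD _ (hytm j) _ hx0m]
  have t2 : ‖xt j - P‖ ≤ s + ‖yt (j + 1) - P‖ := by
    have := norm_add_le (xt j - yt (j + 1)) (yt (j + 1) - P)
    rw [sub_add_sub_cancel] at this
    exact this
  rw [norm_smul, Real.norm_of_nonneg hM.le] at hG
  push Not at hG
  have t3 : M * ‖xt j - P‖ ≤ 2 * (M * s) + e / (4 * D) := by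
    have h1 := mul_le_mul_of_nonneg_left t2 hM.le
    have h2 := mul_le_mul_of_nonneg_left t1 hmu.le
    have h3 : mu * s ≤ M * s := mul_le_mul_of_nonneg_right (by linarith) hs0
    nlinarith
  have t4 : e / (8 * D) < M * s := by
    have e1 : e / (2 * D) = 4 * (e / (8 * D)) := by field_simp; norm_num
    have e2 : e / (4 * D) = 2 * (e / (8 * D)) := by field_simp; norm_num
    linarith
  have t5 : e < 8 * D * (M * s) := by
    rw [div_lt_iff₀ (by positivity)] at t4; linarith
  have t6 : e ^ 2 < (8 * D * (M * s)) ^ 2 := pow_lt_pow_left₀ t5 he.le (by norm_num)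
  set W := (1 + Real.sqrt (mu / (2 * L))) ^ j with hW
  have hW0 : 0 < W := by have := Real.sqrt_nonneg (mu / (2 * L)); positivity
  have t7 : W * s ^ 2 ≤ 2 * D ^ 2 := by
    have : W / (2 * L) * L * s ^ 2 ≤ D ^ 2 := by
      refine le_trans ?_ r1
      gcongr
    have e : W / (2 * L) * L * s ^ 2 = W * s ^ 2 / 2 := by field_simp
    linarith
  calc W * e ^ 2 < W * (8 * D * (M * s)) ^ 2 := by gcongr
    _ = 64 * D ^ 2 * M ^ 2 * (W * s ^ 2) := by ring
    _ ≤ 64 * D ^ 2 * M ^ 2 * (2 * D ^ 2) := by gcongr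
    _ = _ := by ring

lemma self_le_rpow_464 (S : ℝ) (hS : 1 ≤ S) : S ≤ S ^ (464 : ℝ) := by
  have h : (1 : ℝ) ≤ 464 := by norm_num
  generalize (464 : ℝ) = c at h ⊢
  have := Real.rpow_le_rpow_of_exponent_le hS h
  rwa [Real.rpow_one] at this

/-!
STATEMENT 3 (Theorem: total iteration-complexity of the I-ALM with `ε₀ = ε`, `σ = 1/2`,
`ρ = ε⁻¹`).  There are universal constants (the factor and polylog exponent `c`) such that
every run of Algorithm 3 produces an `ε`-primal-dual solution within the stated number of
total ACG iterations.
-/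

theorem ialm_complexity :
    ∃ c : ℝ, 0 < c ∧
      ∀ (n m : ℕ) (domh : Set (Euc n)) (f h : Euc n → ℝ) (f' : Euc n → Euc n)
        (A : Euc n →L[ℝ] Euc m) (bvec : Euc m)
        (Lf D eps eps0 alpha sigma rho : ℝ)
        -- standing assumptions
        (_ : 0 < Lf) (_ : ConvexOn ℝ Set.univ f) (_ : HasLipGrad f f' Lf)
        (_ : LowerSemicontinuous f)
        (_ : ConvexOn ℝ domh h) (_ : IsClosed domh)
        (_ : LowerSemicontinuousOn h domh) (_ : domh.Nonempty)
        (_ : ∃ xs ∈ intrinsicInterior ℝ domh, A xs = bvec)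
        (_ : 1 ≤ D) (_ : ∀ u ∈ domh, ∀ w ∈ domh, ‖u - w‖ ≤ D)
        -- parameter choices of the theorem
        (_ : 0 < eps) (_ : 0 < alpha) (_ : alpha < 1)
        (_ : eps0 = eps) (_ : sigma = 1 / 2) (_ : rho = eps⁻¹)
        -- a run of Algorithm 3
        (xseq : ℕ → Euc n) (lamseq : ℕ → Euc m)
        (xin yin xtin ytin : ℕ → ℕ → Euc n) (ain Ain tauin : ℕ → ℕ → ℝ)
        (P Gm : ℕ → ℕ → Euc n) (J : ℕ → ℕ)
        (_ : ALMSpec domh f h f' A bvec Lf D rho eps eps0 alpha sigma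
            xseq lamseq xin yin xtin ytin ain Ain tauin P Gm J)
        -- the Lagrangian dual, a maximizer `lamstar`, and `R_Λ = dist(λ₀, Λ_*)` (here `λ₀ = 0`)
        (d : Euc m → ℝ)
        (_ : ∀ lam : Euc m,
            IsLeast ((fun x => f x + h x + ⟪lam, A x - bvec⟫) '' domh) (d lam))
        (lamstar : Euc m) (RLam : ℝ)
        (_ : ∀ nu : Euc m, d nu ≤ d lamstar)
        (_ : RLam = ‖lamstar‖)
        (_ : ∀ lam' : Euc m, (∀ nu, d nu ≤ d lam') → RLam ≤ ‖lam'‖),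
        ∃ K : ℕ,
          -- `(x_{K+1}, λ_{K+1})` is an `ε`-primal-dual solution
          (∃ v ∈ subdiffOn domh
              (fun u => f u + h u + ⟪lamseq (K + 1), A u - bvec⟫) (xseq (K + 1)),
            ‖v‖ ≤ eps) ∧
          ‖A (xseq (K + 1)) - bvec‖ ≤ eps ∧
          -- total number of ACG iterations
          (∑ k ∈ Finset.range (K + 1), ((J k : ℝ) + 1)) ≤
            c * (1 + |Real.log D| + |Real.log Lf| + |Real.log ‖A‖| +
                |Real.log eps| + |Real.log (1 - alpha)|) ^ c *
              ((1 + RLam ^ 2) *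
                (1 + D * (Real.sqrt Lf / Real.sqrt eps + ‖A‖ / eps))) := by
  refine ⟨464, by norm_num, ?_⟩
  intro n m domh f h f' A bvec Lf D eps eps0 alpha sigma rho hLf hfc hfl _ hhc _ _ _ _ hD1 hD heps
    hal0 hal1 heps0 hsig hrho xseq lamseq xin yin xtin ytin ain Ain tauin P Gm J hS d hd lamstar
    RLam hmax hR _
  subst heps0 hsig hrho
  obtain ⟨hlam0, hacg, hprox, hGm, hJ1, hJ2, hxs, hlam⟩ := hS
  set e : ℕ → ℝ := epsALM eps0 alpha (1 / 2) eps0⁻¹ eps0 with hedef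
  have hD0 : 0 < D := by linarith
  have he_eq : ∀ k, e k = (eps0 * alpha ^ k + eps0 / 2) / 2 := by
    intro k; rw [hedef]; unfold epsALM; field_simp
  have hel : ∀ k, eps0 / 4 ≤ e k := by
    intro k
    rw [he_eq]
    have : 0 < eps0 * alpha ^ k := by positivity
    linarith
  have heu : ∀ k, e k ≤ 3 / 4 * eps0 := by
    intro k
    rw [he_eq]
    have : eps0 * alpha ^ k ≤ eps0 * 1 :=
      mul_le_mul_of_nonneg_left (pow_le_one₀ hal0.le hal1.le) heps.le
    linarith
  have hepos : ∀ k, 0 < e k := fun k => by linarith [hel k]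
  have hmu : ∀ k, 0 < e k / (4 * D ^ 2) := fun k => by have := hepos k; positivity
  set L := Lf + eps0⁻¹ * ‖A‖ ^ 2 with hLdef
  have hL : 0 < L := by positivity
  have hMpos : ∀ k, 0 < 2 * L + e k / (4 * D ^ 2) := fun k => by have := hmu k; positivity
  have hq : ∀ lam : Euc m, Sand (fun u => f u + ⟪lam, A u - bvec⟫ + eps0⁻¹ / 2 * ‖A u - bvec‖ ^ 2)
      (augGrad f' A bvec eps0⁻¹ lam) 0 L := fun lam =>
    sand_aug f f' Lf hfc hfl A bvec lam eps0⁻¹ (by positivity)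
  -- the new iterate is the prox point
  have hxP : ∀ k, xseq (k + 1) = P k (J k) := by
    intro k
    rw [hxs, hGm, smul_smul, inv_mul_cancel₀ (hMpos k).ne', one_smul, sub_sub_cancel]
  have hxm : ∀ k, xseq (k + 1) ∈ domh := fun k => by rw [hxP]; exact (hprox k (J k)).1
  -- approximate stationarity
  have hv : ∀ k, ∃ v ∈ subdiffOn domh
      (fun u => f u + h u + ⟪lamseq (k + 1), A u - bvec⟫) (xseq (k + 1)),
      ‖v‖ ≤ e k / (2 * D) := by
    intro k
    set M := 2 * L + e k / (4 * D ^ 2) with hMd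
    set z := xtin k (J k) with hz
    set p := P k (J k) with hp
    set q' := augGrad f' A bvec eps0⁻¹ (lamseq k) with hq'
    refine ⟨M • (z - p) + q' p - q' z, ?_, ?_⟩
    · intro u hu
      rw [hxP k]
      have h1 := prox_ineq domh h hhc M (q' z) z p (hprox k (J k)).1
        (fun w hw => prox_conv domh h M (hMpos k) _ _ _ (hprox k (J k)) w hw) u hu
      have h2 := convex_lower f f' hfc hfl.1 p u
      have h3 : ⟪q' p, u - p⟫ = ⟪f' p, u - p⟫ + ⟪lamseq (k + 1), A (u - p)⟫ := by
        rw [hlam k, hxP k, hq']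
        unfold augGrad
        rw [inner_add_left, inner_add_left, real_inner_smul_left,
          ContinuousLinearMap.adjoint_inner_left, ContinuousLinearMap.adjoint_inner_left,
          inner_add_left, real_inner_smul_left]
        ring
      have h4 : ⟪lamseq (k + 1), A u - bvec⟫ =
          ⟪lamseq (k + 1), A p - bvec⟫ + ⟪lamseq (k + 1), A (u - p)⟫ := by
        rw [← inner_add_right, map_sub]; congr 1; abel
      have h5 : ⟪M • (z - p) + q' p - q' z, u - p⟫ =
          ⟪M • (z - p) - q' z, u - p⟫ + ⟪q' p, u - p⟫ := by
        rw [← inner_add_left]; congr 1; abel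
      simp only []
      rw [h5, h3, h4]
      linarith
    · have h1 := v_bound _ _ L M hL (by have := hmu k; linarith) (hq (lamseq k)) z p
      refine h1.trans ?_
      have h2 := hJ1 k
      rwa [hGm] at h2
  -- one outer step
  have hout : ∀ k, ‖lamseq (k + 1) - lamstar‖ ^ 2 + ‖lamseq (k + 1) - lamseq k‖ ^ 2 ≤
      ‖lamseq k - lamstar‖ ^ 2 + 3 / 4 := by
    intro k
    obtain ⟨v, hv1, hv2⟩ := hv k
    obtain ⟨u, hu, hdu⟩ := (hd (lamseq (k + 1))).1
    have h1 := hv1 u hu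
    have h2 := (hd lamstar).2 ⟨_, hxm k, rfl⟩
    have h3 := hmax (lamseq (k + 1))
    simp only [] at h1 h2 hdu
    have h4 : -⟪v, u - xseq (k + 1)⟫ ≤ e k / 2 := by
      have a1 : -⟪v, u - xseq (k + 1)⟫ ≤ ‖v‖ * ‖u - xseq (k + 1)‖ := by
        rw [← inner_neg_left, ← norm_neg v]; exact real_inner_le_norm _ _
      have a2 : ‖v‖ * ‖u - xseq (k + 1)‖ ≤ e k / (2 * D) * D :=
        mul_le_mul hv2 (hD _ hu _ (hxm k)) (norm_nonneg _) ((norm_nonneg _).trans hv2)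
      have a3 : e k / (2 * D) * D = e k / 2 := by field_simp
      linarith
    set r := A (xseq (k + 1)) - bvec with hr
    have h5 : ⟪lamseq (k + 1) - lamstar, r⟫ ≤ e k / 2 := by
      rw [inner_sub_left]; linarith
    have h6 : lamseq (k + 1) - lamseq k = eps0⁻¹ • r := by rw [hlam k]; abel
    have h7 : ⟪lamseq (k + 1) - lamstar, lamseq (k + 1) - lamseq k⟫ ≤ 3 / 8 := by
      rw [h6, real_inner_smul_right]
      calc eps0⁻¹ * ⟪lamseq (k + 1) - lamstar, r⟫ ≤ eps0⁻¹ * (3 / 8 * eps0) := by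
            apply mul_le_mul_of_nonneg_left _ (by positivity)
            linarith [heu k]
        _ = 3 / 8 := by field_simp
    have h8 : lamseq k - lamstar =
        (lamseq (k + 1) - lamstar) - (lamseq (k + 1) - lamseq k) := by abel
    have h9 := norm_sub_sq_real (lamseq (k + 1) - lamstar) (lamseq (k + 1) - lamseq k)
    rw [← h8] at h9
    linarith
  have hsum : ∀ N : ℕ, ‖lamseq N - lamstar‖ ^ 2 +
      ∑ k ∈ Finset.range N, ‖lamseq (k + 1) - lamseq k‖ ^ 2 ≤ RLam ^ 2 + 3 / 4 * N := by
    intro N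
    induction N with
    | zero => simp [hlam0, hR]
    | succ N ih =>
      rw [Finset.sum_range_succ]
      push_cast
      linarith [hout N]
  -- existence of a good outer iteration
  have hK : ∃ K : ℕ, ((K : ℝ) + 1 ≤ 4 * RLam ^ 2 + 1) ∧
      ‖lamseq (K + 1) - lamseq K‖ ≤ 1 := by
    by_contra hcon
    push Not at hcon
    set N := ⌊4 * RLam ^ 2⌋₊ + 1 with hN
    have hN1 : 4 * RLam ^ 2 < N := by rw [hN]; push_cast; exact Nat.lt_floor_add_one _
    have hge : (N : ℝ) ≤ ∑ k ∈ Finset.range N, ‖lamseq (k + 1) - lamseq k‖ ^ 2 := by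
      have : ∑ k ∈ Finset.range N, (1 : ℝ) ≤
          ∑ k ∈ Finset.range N, ‖lamseq (k + 1) - lamseq k‖ ^ 2 := by
        apply Finset.sum_le_sum
        intro k hk
        have hk' : k ≤ ⌊4 * RLam ^ 2⌋₊ := by
          have := Finset.mem_range.1 hk; omega
        have h1 : (k : ℝ) ≤ 4 * RLam ^ 2 := (Nat.le_floor_iff (by positivity)).1 hk'
        have h2 := hcon k (by linarith)
        exact one_le_pow₀ h2.le
      simpa using this
    have := hsum N
    nlinarith [sq_nonneg ‖lamseq N - lamstar‖]
  obtain ⟨K, hK1, hK2⟩ := hK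
  refine ⟨K, ?_, ?_, ?_⟩
  · obtain ⟨v, hv1, hv2⟩ := hv K
    refine ⟨v, hv1, hv2.trans ?_⟩
    rw [div_le_iff₀ (by positivity)]
    have := heu K
    nlinarith
  · rw [hlam K, add_sub_cancel_left, norm_smul, Real.norm_of_nonneg (by positivity),
      inv_mul_le_iff₀ heps, mul_one] at hK2
    exact hK2
  · set S := 1 + |Real.log D| + |Real.log Lf| + |Real.log ‖A‖| +
                |Real.log eps0| + |Real.log (1 - alpha)| with hSd
    set B := 1 + D * (Real.sqrt Lf / Real.sqrt eps0 + ‖A‖ / eps0) with hB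
    have hS1 : 1 ≤ S := by
      have a1 := abs_nonneg (Real.log D)
      have a2 := abs_nonneg (Real.log Lf)
      have a3 := abs_nonneg (Real.log ‖A‖)
      have a4 := abs_nonneg (Real.log eps0)
      have a5 := abs_nonneg (Real.log (1 - alpha))
      linarith
    have hB1 : 1 ≤ B := by
      have : 0 ≤ D * (Real.sqrt Lf / Real.sqrt eps0 + ‖A‖ / eps0) := by positivity
      linarith
    have hSB : 1 ≤ S * B := one_le_mul_of_one_le_of_one_le hS1 hB1
    have hJ : ∀ k, (J k : ℝ) + 1 ≤ 116 * (S * B) := by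
      intro k
      rcases Nat.eq_zero_or_pos (J k) with h0 | h0
      · rw [h0]; push_cast; linarith
      · obtain ⟨j, hj⟩ : ∃ j, J k = j + 1 := ⟨J k - 1, by omega⟩
        have hfail := hJ2 k j (by omega)
        rw [hGm] at hfail
        have hsand := sand_quad _ _ 0 L (e k / (4 * D ^ 2)) (hq (lamseq k)) (xseq k)
        rw [zero_add] at hsand
        have hcoef : e k / (4 * D ^ 2) / 2 = e k / (8 * D ^ 2) := by field_simp; ring
        rw [hcoef] at hsand
        have h1 := inner_fail domh _ h (augGrad f' A bvec eps0⁻¹ (lamseq k)) L D (e k) (xseq k)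
          (xin k) (yin k) (xtin k) (ytin k) (ain k) (Ain k) (tauin k) hL (hepos k) hD1 hsand hhc hD
          (hacg k) j (P k j) (hprox k j) hfail
        have h2 := numeric D Lf ‖A‖ eps0 (e k) S hD1 hLf (norm_nonneg _) heps (hel k)
          (by have := abs_nonneg (Real.log (1 - alpha)); linarith) j h1
        rw [hj]; push_cast
        have h3 : 114 * S * B = 114 * (S * B) := by ring
        linarith
    have hsumJ : ∑ k ∈ Finset.range (K + 1), ((J k : ℝ) + 1) ≤ ((K : ℝ) + 1) * (116 * (S * B)) := by
      calc ∑ k ∈ Finset.range (K + 1), ((J k : ℝ) + 1)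
          ≤ ∑ _k ∈ Finset.range (K + 1), 116 * (S * B) := Finset.sum_le_sum fun k _ => hJ k
        _ = _ := by simp
    have hSp : S ≤ S ^ (464 : ℝ) := self_le_rpow_464 S hS1
    generalize S ^ (464 : ℝ) = Z at hSp ⊢
    calc ∑ k ∈ Finset.range (K + 1), ((J k : ℝ) + 1) ≤ ((K : ℝ) + 1) * (116 * (S * B)) := hsumJ
      _ ≤ (4 * (1 + RLam ^ 2)) * (116 * (S * B)) := by
          apply mul_le_mul_of_nonneg_right _ (by linarith)
          linarith
      _ = 464 * S * ((1 + RLam ^ 2) * B) := by ring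
      _ ≤ 464 * Z * ((1 + RLam ^ 2) * B) := by
          apply mul_le_mul_of_nonneg_right _ (by positivity)
          linarith
end
end
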